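/- arXiv:1110.2706 — 2 statements merged into one kernel-verified Lean document; each statement's English description precedes it below -/
import Mathlib

section
/- Let p ≥ 3, d ∈ {3,…,p}, n ≥ d, and let U be a k-subspace of 𝔪^{d−1}·W_{n,d} (note 𝔪·(𝔪^{d−1}W_{n,d}) = 0, so U is an A-submodule). Then the quotient W_{n,d}/U is an indecomposable A-module with the equal images property, of constant Jordan type ⊕_{i=1}^{d−2} [i] ⊕ (dim_k U + 1)[d−1] ⊕ (n−d+1−dim_k U)[d]. -/
open MvPolynomial Module

set_option maxHeartbeats 1000000
set_option synthInstance.maxHeartbeats 400000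

noncomputable section

/-- The defining ideal `(X^p, Y^p)` of the polynomial ring in two variables. -/
def relI (k : Type) [Field k] (p : ℕ) : Ideal (MvPolynomial (Fin 2) k) :=
  Ideal.span {(X 0 : MvPolynomial (Fin 2) k) ^ p, (X 1 : MvPolynomial (Fin 2) k) ^ p}

/-- The algebra `A = k[X,Y]/(X^p, Y^p)`. -/
abbrev Amod (k : Type) [Field k] (p : ℕ) : Type :=
  MvPolynomial (Fin 2) k ⧸ relI k p

variable (k : Type) [Field k] (p : ℕ)

/-- `x`, the image of `X` in `A`. -/
def xA : Amod k p := Ideal.Quotient.mk (relI k p) (X 0)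

/-- `y`, the image of `Y` in `A`. -/
def yA : Amod k p := Ideal.Quotient.mk (relI k p) (X 1)

/-- The maximal ideal `𝔪 = (x, y)` of `A`. -/
def mA : Ideal (Amod k p) := Ideal.span {xA k p, yA k p}

/-- A point operator: `u = α x + β y` with `(α, β) ≠ (0, 0)`. -/
def IsPointOp (u : Amod k p) : Prop :=
  ∃ α β : k, (α ≠ 0 ∨ β ≠ 0) ∧ u = α • xA k p + β • yA k p

/-- Equal images property: `u M = 𝔪 M` for every point operator `u`. -/
def EIP (M : Type) [AddCommGroup M] [Module (Amod k p) M] : Prop :=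
  ∀ u : Amod k p, IsPointOp k p u →
    LinearMap.range (LinearMap.lsmul (Amod k p) M u)
      = mA k p • (⊤ : Submodule (Amod k p) M)

/-- `M` lies in `EIP_d`: equal images property and `𝔪^d M = 0`. -/
def EIPd (d : ℕ) (M : Type) [AddCommGroup M] [Module (Amod k p) M] : Prop :=
  EIP k p M ∧ (mA k p) ^ d • (⊤ : Submodule (Amod k p) M) = ⊥


/-- The standard basis vector `v_i` of the free module `A^n`. -/
def stdV (n : ℕ) (i : Fin n) : Fin n → Amod k p := Pi.single i 1

/-- The set of defining relations of the module `W_{n,d}` inside the free module `A^n`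
(indices of `v_1, …, v_n` are `0, …, n-1`): `x·v_1`, `y·v_n`, `x^d·v_i` for `2 ≤ i ≤ n`,
and `y·v_i − x·v_{i+1}` for `1 ≤ i ≤ n−1`. -/
def NSet (n d : ℕ) : Set (Fin n → Amod k p) :=
  (⋃ (i : Fin n) (_ : i.val = 0), {xA k p • stdV k p n i}) ∪
  (⋃ (i : Fin n) (_ : i.val = n - 1), {yA k p • stdV k p n i}) ∪
  (⋃ (i : Fin n) (_ : i.val ≠ 0), {(xA k p) ^ d • stdV k p n i}) ∪
  (⋃ (i : Fin n) (j : Fin n) (_ : j.val = i.val + 1),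
    {yA k p • stdV k p n i - xA k p • stdV k p n j})

/-- The submodule `N_{n,d} ⊆ A^n` of defining relations of `W_{n,d}`. -/
def NSub (n d : ℕ) : Submodule (Amod k p) (Fin n → Amod k p) :=
  Submodule.span (Amod k p) (NSet k p n d)

/-- The module `W_{n,d} = A^n / N_{n,d}`. -/
abbrev Wmod (n d : ℕ) : Type := (Fin n → Amod k p) ⧸ NSub k p n d

/-- `M` has constant Jordan type `⊕ a_i [i]`: for every point operator `u`, the nilpotent
operator `u_M` has exactly `a i` Jordan blocks of size `i` (`1 ≤ i ≤ p`), expressed through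
ranks: `rank(u_M^j) = Σ_{i=j+1}^p (i−j)·a i` for `1 ≤ j ≤ p−1` and
`dim_k M = Σ_{i=1}^p i·a i`. -/
def ConstantJordanType (a : ℕ → ℕ) (M : Type) [AddCommGroup M] [Module (Amod k p) M]
    [Module k M] [IsScalarTower k (Amod k p) M] : Prop :=
  finrank k M = ∑ i ∈ Finset.Icc 1 p, i * a i ∧
  ∀ u : Amod k p, IsPointOp k p u → ∀ j : ℕ, 1 ≤ j → j ≤ p - 1 →
    finrank k (↥(LinearMap.range ((LinearMap.lsmul (Amod k p) M u) ^ j)))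
      = ∑ i ∈ Finset.Icc (j + 1) p, (i - j) * a i

/-- `M` is an indecomposable `A`-module: it is nonzero and admits no nontrivial internal
direct sum decomposition. -/
def IsIndecomposableMod (M : Type) [AddCommGroup M] [Module (Amod k p) M] : Prop :=
  Nontrivial M ∧ ∀ N N' : Submodule (Amod k p) M, IsCompl N N' → N = ⊥ ∨ N' = ⊥

/-! ### Bridging lemmas -/

lemma smul_eq_algebraMap_mul (a : k) (z : Amod k p) :
    a • z = algebraMap k (Amod k p) a * z := by
  obtain ⟨f, rfl⟩ := Ideal.Quotient.mk_surjective z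
  have h1 : a • Ideal.Quotient.mk (relI k p) f = Ideal.Quotient.mk (relI k p) (a • f) := rfl
  have h2 : algebraMap k (Amod k p) a = Ideal.Quotient.mk (relI k p) (C a) := rfl
  rw [h1, h2, ← map_mul, smul_eq_C_mul]

lemma mA_pow_succ (j : ℕ) : mA k p ^ (j + 1) = mA k p ^ j * mA k p := Submodule.pow_succ _

lemma mA_pow_two : mA k p ^ 2 = mA k p * mA k p := by
  rw [mA_pow_succ]
  congr 1
  exact Submodule.pow_one _

/-! ### A concrete model giving linear independence -/

/-- The monomials that survive. -/
def GoodExp (n d : ℕ) (s : Fin 2 →₀ ℕ) : Prop := s 0 < n ∧ s 1 < n ∧ s 0 + s 1 < n - 1 + d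

lemma GoodExp.mono {n d : ℕ} {s t : Fin 2 →₀ ℕ} (h : GoodExp n d s) (hts : t ≤ s) :
    GoodExp n d t := by
  obtain ⟨h0, h1, h2⟩ := h
  have a := hts 0
  have b := hts 1
  refine ⟨?_, ?_, ?_⟩ <;> omega

/-- The monomial ideal of polynomials with no good monomial. -/
def Jid (n d : ℕ) : Ideal (MvPolynomial (Fin 2) k) where
  carrier := {f | ∀ s, GoodExp n d s → coeff s f = 0}
  add_mem' := by
    intro a b ha hb s hs
    rw [coeff_add, ha s hs, hb s hs, add_zero]
  zero_mem' := by
    intro s _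
    exact coeff_zero s
  smul_mem' := by
    classical
    intro c f hf s hs
    rw [smul_eq_mul, coeff_mul]
    refine Finset.sum_eq_zero fun ab hab => ?_
    rw [Finset.HasAntidiagonal.mem_antidiagonal] at hab
    rw [hf ab.2 (hs.mono (hab ▸ le_add_self)), mul_zero]

lemma mem_Jid (n d : ℕ) (f : MvPolynomial (Fin 2) k) :
    f ∈ Jid k n d ↔ ∀ s, GoodExp n d s → coeff s f = 0 := Iff.rfl

/-- Exponent vector. -/
def expo (a b : ℕ) : Fin 2 →₀ ℕ := Finsupp.single 0 a + Finsupp.single 1 b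

lemma XY_eq (a b : ℕ) : (X 0 ^ a * X 1 ^ b : MvPolynomial (Fin 2) k) = monomial (expo a b) 1 := by
  rw [X_pow_eq_monomial, X_pow_eq_monomial, monomial_mul, one_mul, expo]

@[simp] lemma expo_zero (a b : ℕ) : expo a b 0 = a := by simp [expo]
@[simp] lemma expo_one (a b : ℕ) : expo a b 1 = b := by simp [expo]

lemma XY_mem (n d a b : ℕ) (h : ¬ (a < n ∧ b < n ∧ a + b < n - 1 + d)) :
    (X 0 ^ a * X 1 ^ b : MvPolynomial (Fin 2) k) ∈ Jid k n d := by
  classical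
  rw [mem_Jid]
  intro s hs
  rw [XY_eq, coeff_monomial, if_neg]
  rintro rfl
  apply h
  simpa [GoodExp] using hs

/-- Target module of the model. -/
abbrev Tmod (n d : ℕ) : Type :=
  Submodule.torsionBySet (MvPolynomial (Fin 2) k) (MvPolynomial (Fin 2) k ⧸ Jid k n d) (relI k p)

lemma tgen_mem (n d : ℕ) (hdp : d ≤ p) (i : Fin n) :
    (Ideal.Quotient.mk (Jid k n d) (X 0 ^ (n - 1 - i) * X 1 ^ (i : ℕ))) ∈
    Submodule.torsionBySet (MvPolynomial (Fin 2) k) (MvPolynomial (Fin 2) k ⧸ Jid k n d)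
      (relI k p) := by
  rw [relI, ← Submodule.torsionBySet_eq_torsionBySet_span, Submodule.mem_torsionBySet_iff]
  have hi := i.2
  rintro ⟨a, ha | ha⟩
  · subst ha
    show Ideal.Quotient.mk (Jid k n d) (X 0 ^ p * _) = 0
    rw [Ideal.Quotient.eq_zero_iff_mem, ← mul_assoc, ← pow_add]
    apply XY_mem
    omega
  · rw [Set.mem_singleton_iff] at ha
    subst ha
    show Ideal.Quotient.mk (Jid k n d) (X 1 ^ p * _) = 0
    rw [Ideal.Quotient.eq_zero_iff_mem, mul_left_comm, ← pow_add]
    apply XY_mem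
    omega

/-- Images of the generators. -/
def tgen (n d : ℕ) (hdp : d ≤ p) (i : Fin n) : Tmod k p n d := ⟨_, tgen_mem k p n d hdp i⟩

/-- The model map on the free module. -/
def preModel (n d : ℕ) (hdp : d ≤ p) : (Fin n → Amod k p) →ₗ[Amod k p] Tmod k p n d :=
  Fintype.linearCombination (Amod k p) (tgen k p n d hdp)

lemma preModel_stdV (n d : ℕ) (hdp : d ≤ p) (i : Fin n) :
    preModel k p n d hdp (stdV k p n i) = tgen k p n d hdp i := by
  classical
  rw [preModel, stdV, Fintype.linearCombination_apply_single, one_smul]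

lemma mk_smul_tgen (n d : ℕ) (hdp : d ≤ p) (i : Fin n) (f : MvPolynomial (Fin 2) k) :
    ((Ideal.Quotient.mk (relI k p) f • tgen k p n d hdp i : Tmod k p n d) :
      MvPolynomial (Fin 2) k ⧸ Jid k n d) =
    Ideal.Quotient.mk (Jid k n d) (f * (X 0 ^ (n - 1 - i) * X 1 ^ (i : ℕ))) := rfl

lemma x_smul_tgen (n d : ℕ) (hdp : d ≤ p) (i : Fin n) (j : ℕ) :
    ((xA k p ^ j • tgen k p n d hdp i : Tmod k p n d) :
      MvPolynomial (Fin 2) k ⧸ Jid k n d) =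
    Ideal.Quotient.mk (Jid k n d) (X 0 ^ (j + (n - 1 - i)) * X 1 ^ (i : ℕ)) := by
  rw [xA, ← map_pow, mk_smul_tgen, ← mul_assoc, ← pow_add]

lemma y_smul_tgen (n d : ℕ) (hdp : d ≤ p) (i : Fin n) :
    ((yA k p • tgen k p n d hdp i : Tmod k p n d) :
      MvPolynomial (Fin 2) k ⧸ Jid k n d) =
    Ideal.Quotient.mk (Jid k n d) (X 0 ^ (n - 1 - i) * X 1 ^ (i + 1 : ℕ)) := by
  rw [yA, mk_smul_tgen, mul_left_comm, ← pow_succ']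

lemma NSub_le_ker (n d : ℕ) (hdp : d ≤ p) :
    NSub k p n d ≤ LinearMap.ker (preModel k p n d hdp) := by
  rw [NSub, Submodule.span_le]
  intro z hz
  simp only [NSet, Set.mem_union, Set.mem_iUnion, Set.mem_singleton_iff] at hz
  rw [SetLike.mem_coe, LinearMap.mem_ker]
  rcases hz with ((⟨i, hi, rfl⟩ | ⟨i, hi, rfl⟩) | ⟨i, hi, rfl⟩) | ⟨i, j, hij, rfl⟩
  · have := i.2
    rw [map_smul, preModel_stdV, Subtype.ext_iff, ← pow_one (xA k p), x_smul_tgen]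
    apply Ideal.Quotient.eq_zero_iff_mem.2 (XY_mem _ _ _ _ _ ?_)
    omega
  · have := i.2
    rw [map_smul, preModel_stdV, Subtype.ext_iff, y_smul_tgen]
    apply Ideal.Quotient.eq_zero_iff_mem.2 (XY_mem _ _ _ _ _ ?_)
    omega
  · have := i.2
    rw [map_smul, preModel_stdV, Subtype.ext_iff, x_smul_tgen]
    apply Ideal.Quotient.eq_zero_iff_mem.2 (XY_mem _ _ _ _ _ ?_)
    omega
  · have := j.2
    rw [map_sub, map_smul, map_smul, preModel_stdV, preModel_stdV, sub_eq_zero,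
      Subtype.ext_iff, y_smul_tgen, ← pow_one (xA k p), x_smul_tgen]
    congr 3 <;> omega

/-- The model map on `W`. -/
def model (n d : ℕ) (hdp : d ≤ p) : Wmod k p n d →ₗ[Amod k p] Tmod k p n d :=
  (NSub k p n d).liftQ (preModel k p n d hdp) (NSub_le_ker k p n d hdp)

/-- Coefficient functional on the quotient by `J`. -/
def coeffQ (n d : ℕ) (s : Fin 2 →₀ ℕ) (hs : GoodExp n d s) :
    (MvPolynomial (Fin 2) k ⧸ Jid k n d) →ₗ[k] k :=
  (Submodule.liftQ ((Jid k n d).restrictScalars k) (lcoeff k s)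
    (fun f hf => by exact hf s hs)) ∘ₗ
  (Submodule.Quotient.restrictScalarsEquiv k (Jid k n d)).symm.toLinearMap

lemma coeffQ_mk (n d : ℕ) (s : Fin 2 →₀ ℕ) (hs : GoodExp n d s) (f : MvPolynomial (Fin 2) k) :
    coeffQ k n d s hs (Ideal.Quotient.mk (Jid k n d) f) = coeff s f := rfl

/-- The generators of `W`, extended by zero. -/
def vW (n d : ℕ) (i : ℕ) : Wmod k p n d :=
  if h : i < n then (NSub k p n d).mkQ (stdV k p n ⟨i, h⟩) else 0

lemma goodExp_im {n d i m : ℕ} (hi : i < d) (him : i ≤ m) (hm : m < n) :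
    GoodExp n d (expo (i + (n - 1 - m)) m) := by
  refine ⟨?_, ?_, ?_⟩ <;> simp <;> omega

/-- Coordinates on `W`. -/
def cf (n d : ℕ) (hdp : d ≤ p) (i m : ℕ) (hi : i < d) (him : i ≤ m) (hm : m < n) :
    Wmod k p n d →ₗ[k] k :=
  coeffQ k n d _ (goodExp_im hi him hm) ∘ₗ
    ((Submodule.subtype (Submodule.torsionBySet (MvPolynomial (Fin 2) k)
      (MvPolynomial (Fin 2) k ⧸ Jid k n d) (relI k p))).restrictScalars k ∘ₗ
    (model k p n d hdp).restrictScalars k)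

lemma cf_apply (n d : ℕ) (hdp : d ≤ p) (i m : ℕ) (hi : i < d) (him : i ≤ m) (hm : m < n)
    (i' m' : ℕ) (hm' : m' < n) :
    cf k p n d hdp i m hi him hm (xA k p ^ i' • vW k p n d m') =
      if i' = i ∧ m' = m then 1 else 0 := by
  classical
  have h1 : model k p n d hdp (xA k p ^ i' • vW k p n d m') =
      xA k p ^ i' • tgen k p n d hdp ⟨m', hm'⟩ := by
    rw [map_smul, vW, dif_pos hm', model, Submodule.mkQ_apply, Submodule.liftQ_apply,
      preModel_stdV]
  show coeffQ k n d _ (goodExp_im hi him hm)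
    ((model k p n d hdp (xA k p ^ i' • vW k p n d m') : Tmod k p n d) :
      MvPolynomial (Fin 2) k ⧸ Jid k n d) = _
  rw [h1, x_smul_tgen, coeffQ_mk, XY_eq, coeff_monomial]
  congr 1
  rw [eq_iff_iff]
  constructor
  · intro h
    have a := DFunLike.congr_fun h 0
    have b := DFunLike.congr_fun h 1
    simp at a b
    omega
  · rintro ⟨rfl, rfl⟩
    rfl

/-! ### Generic lemmas -/

section generic

variable {M : Type} [AddCommGroup M] [Module (Amod k p) M]

lemma xA_mem : xA k p ∈ mA k p := Ideal.subset_span (by simp)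
lemma yA_mem : yA k p ∈ mA k p := Ideal.subset_span (by simp)

lemma mA_smul_top_le (N : Submodule (Amod k p) M) (hx : ∀ z : M, xA k p • z ∈ N)
    (hy : ∀ z : M, yA k p • z ∈ N) : mA k p • (⊤ : Submodule (Amod k p) M) ≤ N := by
  rw [Submodule.smul_le]
  intro r hr z _
  obtain ⟨a, b, rfl⟩ := Ideal.mem_span_pair.1 hr
  rw [add_smul, mul_smul, mul_smul]
  exact N.add_mem (N.smul_mem _ (hx _)) (N.smul_mem _ (hy _))

lemma smul_mem_of_gens (v : ℕ → M) (hspan : Submodule.span (Amod k p) (Set.range v) = ⊤)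
    (N : Submodule (Amod k p) M) (r : Amod k p) (h : ∀ i, r • v i ∈ N) (z : M) : r • z ∈ N := by
  have h1 : (⊤ : Submodule (Amod k p) M) ≤ N.comap (LinearMap.lsmul (Amod k p) M r) := by
    rw [← hspan, Submodule.span_le]
    rintro _ ⟨i, rfl⟩
    exact h i
  exact h1 (Submodule.mem_top (x := z))

lemma EIP_of_gens (v : ℕ → M) (n : ℕ)
    (hspan : Submodule.span (Amod k p) (Set.range v) = ⊤)
    (h0 : xA k p • v 0 = 0) (hxy : ∀ i, yA k p • v i = xA k p • v (i + 1))
    (hfin : ∀ i, n ≤ i → v i = 0) : EIP k p M := by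
  rintro u ⟨α, β, hab, rfl⟩
  apply le_antisymm
  · rintro _ ⟨z, rfl⟩
    refine Submodule.smul_mem_smul ?_ Submodule.mem_top
    rw [smul_eq_algebraMap_mul, smul_eq_algebraMap_mul]
    exact Ideal.add_mem _ (Ideal.mul_mem_left _ _ (xA_mem k p))
      (Ideal.mul_mem_left _ _ (yA_mem k p))
  · set N := LinearMap.range (LinearMap.lsmul (Amod k p) M (α • xA k p + β • yA k p)) with hN
    have hu : ∀ z : M, (α • xA k p + β • yA k p) • z ∈ N := fun z => ⟨z, rfl⟩
    have key : ∀ i, xA k p • v i ∈ N := by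
      by_cases hα : α = 0
      · have hβ : β ≠ 0 := by tauto
        intro i
        rcases i with _ | i
        · rw [h0]; exact N.zero_mem
        · rw [← hxy]
          have h1 := N.smul_mem (algebraMap k (Amod k p) β⁻¹) (hu (v i))
          rw [smul_smul] at h1
          convert h1 using 2
          rw [hα, zero_smul, zero_add, ← Algebra.smul_def, smul_smul, inv_mul_cancel₀ hβ,
            one_smul]
      · have : ∀ t i, n ≤ i + t → xA k p • v i ∈ N := by
          intro t
          induction t with
          | zero =>
            intro i hi
            rw [hfin i hi, smul_zero]
            exact N.zero_mem
          | succ t ih =>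
            intro i hi
            have h1 := N.smul_mem (algebraMap k (Amod k p) α⁻¹) (hu (v i))
            have h2 := N.smul_mem (algebraMap k (Amod k p) (α⁻¹ * β)) (ih (i + 1) (by omega))
            have h3 := N.sub_mem h1 h2
            rw [← hxy, smul_smul, smul_smul, ← sub_smul] at h3
            convert h3 using 2
            rw [← Algebra.smul_def, ← Algebra.smul_def, smul_add, smul_smul, smul_smul,
              inv_mul_cancel₀ hα, one_smul, add_sub_cancel_right]
        intro i
        exact this n i (by omega)
    refine mA_smul_top_le k p N (smul_mem_of_gens k p v hspan N _ key)
      (smul_mem_of_gens k p v hspan N _ fun i => ?_)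
    rw [hxy]
    exact key _

lemma EIP.range_pow (h : EIP k p M) (u : Amod k p) (hu : IsPointOp k p u) (j : ℕ) :
    LinearMap.range ((LinearMap.lsmul (Amod k p) M u) ^ j) =
      mA k p ^ j • (⊤ : Submodule (Amod k p) M) := by
  induction j with
  | zero => simp [Module.End.one_eq_id]
  | succ j ih =>
    rw [pow_succ', Module.End.mul_eq_comp, LinearMap.range_comp, ih, Submodule.map_smul'',
      Submodule.map_top, h u hu, ← Submodule.mul_smul, mA_pow_succ]

lemma isPointOp_xA : IsPointOp k p (xA k p) := ⟨1, 0, Or.inl one_ne_zero, by simp⟩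

lemma lsmul_pow_apply (u : Amod k p) (j : ℕ) (z : M) :
    ((LinearMap.lsmul (Amod k p) M u) ^ j) z = u ^ j • z := by
  induction j with
  | zero => simp
  | succ j ih =>
    rw [pow_succ', Module.End.mul_apply, ih, LinearMap.lsmul_apply, smul_smul, ← pow_succ']

variable [Module k M] [IsScalarTower k (Amod k p) M]

lemma kspan_top (S : Submodule k M) (v : ℕ → M)
    (hspan : Submodule.span (Amod k p) (Set.range v) = ⊤)
    (hx : ∀ z ∈ S, xA k p • z ∈ S) (hy : ∀ z ∈ S, yA k p • z ∈ S)
    (hv : ∀ i, v i ∈ S) : S = ⊤ := by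
  have hA : ∀ f : MvPolynomial (Fin 2) k, ∀ z ∈ S, Ideal.Quotient.mk (relI k p) f • z ∈ S := by
    intro f
    induction f using MvPolynomial.induction_on with
    | C a =>
      intro z hz
      have : Ideal.Quotient.mk (relI k p) (C a) = algebraMap k (Amod k p) a := rfl
      rw [this, algebraMap_smul]
      exact S.smul_mem _ hz
    | add f g hf hg =>
      intro z hz
      rw [map_add, add_smul]
      exact S.add_mem (hf z hz) (hg z hz)
    | mul_X f i hf =>
      intro z hz
      rw [map_mul, mul_smul]
      apply hf
      fin_cases i
      · exact hx z hz
      · exact hy z hz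
  let S' : Submodule (Amod k p) M :=
    { carrier := S
      add_mem' := fun ha hb => S.add_mem ha hb
      zero_mem' := S.zero_mem
      smul_mem' := by
        intro c z hz
        obtain ⟨f, rfl⟩ := Ideal.Quotient.mk_surjective c
        exact hA f z hz }
  have h1 : (⊤ : Submodule (Amod k p) M) ≤ S' := by
    rw [← hspan, Submodule.span_le]
    rintro _ ⟨i, rfl⟩
    exact hv i
  rw [eq_top_iff]
  intro z _
  exact h1 (Submodule.mem_top (x := z))

lemma map_smul_top_mem (e : M →ₗ[Amod k p] M) (I : Ideal (Amod k p)) (z : M)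
    (hz : z ∈ I • (⊤ : Submodule (Amod k p) M)) : e z ∈ I • (⊤ : Submodule (Amod k p) M) := by
  have := Submodule.mem_map_of_mem (f := e) hz
  rw [Submodule.map_smul''] at this
  exact Submodule.smul_mono le_rfl le_top this

lemma idem_zero (v : ℕ → M) (d : ℕ)
    (hspan : Submodule.span (Amod k p) (Set.range v) = ⊤)
    (hxy : ∀ i, yA k p • v i = xA k p • v (i + 1))
    (hnil : mA k p ^ d • (⊤ : Submodule (Amod k p) M) = ⊥)
    (hstar : ∀ z : M, xA k p • z ∈ mA k p ^ 2 • (⊤ : Submodule (Amod k p) M) →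
      ∃ c : k, z - c • v 0 ∈ mA k p • (⊤ : Submodule (Amod k p) M))
    (e : M →ₗ[Amod k p] M) (he : ∀ z, e (e z) = e z)
    (hev : e (v 0) ∈ mA k p • (⊤ : Submodule (Amod k p) M)) (z : M) : e z = 0 := by
  have h1 : ∀ i, e (v i) ∈ mA k p • (⊤ : Submodule (Amod k p) M) := by
    intro i
    induction i with
    | zero => exact hev
    | succ i ih =>
      obtain ⟨c, hc⟩ := hstar (e (v (i + 1))) (by
        rw [← map_smul, ← hxy, map_smul, mA_pow_two, Submodule.mul_smul]
        exact Submodule.smul_mem_smul (yA_mem k p) ih)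
      have h2 := map_smul_top_mem k p e _ _ hc
      rw [map_sub, he, LinearMap.map_smul_of_tower] at h2
      have h3 := ((mA k p • (⊤ : Submodule (Amod k p) M)).restrictScalars k).smul_mem c hev
      have h4 := Submodule.add_mem _ h2 h3
      rwa [sub_add_cancel] at h4
  have h2 : ∀ z, e z ∈ mA k p • (⊤ : Submodule (Amod k p) M) := by
    intro z
    have h3 : (⊤ : Submodule (Amod k p) M) ≤
        (mA k p • (⊤ : Submodule (Amod k p) M)).comap e := by
      conv_lhs => rw [← hspan]
      rw [Submodule.span_le]
      rintro _ ⟨i, rfl⟩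
      exact h1 i
    exact h3 (Submodule.mem_top (x := z))
  have h3 : ∀ j : ℕ, LinearMap.range e ≤ mA k p ^ j • (⊤ : Submodule (Amod k p) M) := by
    intro j
    induction j with
    | zero => simp
    | succ j ih =>
      rintro _ ⟨z, rfl⟩
      have h4 := Submodule.mem_map_of_mem (f := e) (ih ⟨z, rfl⟩)
      rw [he, Submodule.map_smul''] at h4
      rw [mA_pow_succ, Submodule.mul_smul]
      refine Submodule.smul_mono le_rfl ?_ h4
      rintro _ ⟨w, _, rfl⟩
      exact h2 w
  have h4 := h3 d ⟨z, rfl⟩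
  rwa [hnil, Submodule.mem_bot] at h4

lemma indec_of (v : ℕ → M) (d : ℕ)
    (hspan : Submodule.span (Amod k p) (Set.range v) = ⊤)
    (h0 : xA k p • v 0 = 0)
    (hxy : ∀ i, yA k p • v i = xA k p • v (i + 1))
    (hnil : mA k p ^ d • (⊤ : Submodule (Amod k p) M) = ⊥)
    (hstar : ∀ z : M, xA k p • z ∈ mA k p ^ 2 • (⊤ : Submodule (Amod k p) M) →
      ∃ c : k, z - c • v 0 ∈ mA k p • (⊤ : Submodule (Amod k p) M))
    (hv0 : v 0 ∉ mA k p • (⊤ : Submodule (Amod k p) M)) : IsIndecomposableMod k p M := by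
  refine ⟨⟨v 0, 0, fun h => hv0 (h ▸ Submodule.zero_mem _)⟩, ?_⟩
  intro N N' hNN
  have main : ∀ e : M →ₗ[Amod k p] M, (∀ z, e (e z) = e z) →
      (∀ z, e z = 0) ∨ (∀ z, z - e z = 0) := by
    intro e he
    obtain ⟨c, hc⟩ := hstar (e (v 0)) (by
      rw [← map_smul, h0, map_zero]
      exact Submodule.zero_mem _)
    by_cases hc1 : c = 1
    · right
      have := idem_zero k p v d hspan hxy hnil hstar (LinearMap.id - e)
        (by intro z; simp [he]) (by
          rw [hc1, one_smul] at hc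
          have := Submodule.neg_mem _ hc
          rwa [neg_sub] at this)
      simpa using this
    · left
      apply idem_zero k p v d hspan hxy hnil hstar e he
      have h2 := map_smul_top_mem k p e _ _ hc
      rw [map_sub, he, LinearMap.map_smul_of_tower] at h2
      have h3 := ((mA k p • (⊤ : Submodule (Amod k p) M)).restrictScalars k).smul_mem
        (1 - c)⁻¹ h2
      have h4 : e (v 0) - c • e (v 0) = (1 - c) • e (v 0) := by rw [sub_smul, one_smul]
      rw [h4, smul_smul, inv_mul_cancel₀ (sub_ne_zero.2 (Ne.symm hc1)), one_smul] at h3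
      exact h3
  have hid : ∀ z, (N.subtype ∘ₗ N.projectionOnto N' hNN) ((N.subtype ∘ₗ N.projectionOnto N' hNN) z)
      = (N.subtype ∘ₗ N.projectionOnto N' hNN) z := by
    intro z
    simp
  rcases main (N.subtype ∘ₗ N.projectionOnto N' hNN) hid with h | h
  · left
    rw [eq_bot_iff]
    intro z hz
    have := h z
    simpa [Submodule.projectionOnto_apply_left hNN ⟨z, hz⟩] using this
  · right
    rw [eq_bot_iff]
    intro z hz
    have := h z
    simpa [Submodule.projectionOnto_apply_right hNN ⟨z, hz⟩] using this

end generic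

/-! ### The module `W` -/

lemma Wmul_smul (n d : ℕ) (a b : Amod k p) (z : Wmod k p n d) : (a * b) • z = a • b • z := by
  obtain ⟨q, rfl⟩ := Submodule.mkQ_surjective _ z
  rw [← map_smul, ← map_smul, ← map_smul, smul_smul]

lemma vW_span (n d : ℕ) : Submodule.span (Amod k p) (Set.range (vW k p n d)) = ⊤ := by
  classical
  rw [eq_top_iff]
  rintro z -
  obtain ⟨q, rfl⟩ := Submodule.mkQ_surjective _ z
  have hq : q = ∑ i, q i • stdV k p n i := by
    funext j
    rw [Finset.sum_apply, Finset.sum_eq_single j]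
    · simp [stdV]
    · intro b _ hb
      simp [stdV, hb.symm]
    · simp
  rw [hq, map_sum]
  refine Submodule.sum_mem _ fun i _ => ?_
  rw [map_smul]
  refine Submodule.smul_mem _ _ (Submodule.subset_span ⟨i.val, ?_⟩)
  rw [vW, dif_pos i.2]

lemma vW_zero (n d i : ℕ) (h : n ≤ i) : vW k p n d i = 0 := by
  rw [vW, dif_neg (by omega)]

lemma NSet_mk (n d : ℕ) (z : Fin n → Amod k p) (hz : z ∈ NSet k p n d) :
    (NSub k p n d).mkQ z = 0 := by
  rw [Submodule.mkQ_apply, Submodule.Quotient.mk_eq_zero]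
  exact Submodule.subset_span hz

lemma x_vW_zero (n d : ℕ) : xA k p • vW k p n d 0 = 0 := by
  by_cases h : 0 < n
  · rw [vW, dif_pos h, ← map_smul]
    apply NSet_mk
    simp only [NSet, Set.mem_union, Set.mem_iUnion, Set.mem_singleton_iff]
    exact Or.inl (Or.inl (Or.inl ⟨⟨0, h⟩, rfl, rfl⟩))
  · rw [vW_zero _ _ _ _ _ (by omega), smul_zero]

lemma y_vW (n d i : ℕ) : yA k p • vW k p n d i = xA k p • vW k p n d (i + 1) := by
  by_cases h : i + 1 < n
  · rw [vW, vW, dif_pos h, dif_pos (by omega), ← map_smul, ← map_smul, ← sub_eq_zero, ← map_sub]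
    apply NSet_mk
    simp only [NSet, Set.mem_union, Set.mem_iUnion, Set.mem_singleton_iff]
    exact Or.inr ⟨⟨i, by omega⟩, ⟨i + 1, h⟩, rfl, rfl⟩
  · rw [vW_zero k p n d (i + 1) (by omega), smul_zero]
    by_cases h' : i < n
    · rw [vW, dif_pos h', ← map_smul]
      apply NSet_mk
      simp only [NSet, Set.mem_union, Set.mem_iUnion, Set.mem_singleton_iff]
      exact Or.inl (Or.inl (Or.inr ⟨⟨i, h'⟩, by simp; omega, rfl⟩))
    · rw [vW_zero _ _ _ _ _ (by omega), smul_zero]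

lemma xd_vW (n d i : ℕ) (hd : 1 ≤ d) : xA k p ^ d • vW k p n d i = 0 := by
  rcases i with _ | i
  · obtain ⟨e, rfl⟩ : ∃ e, d = e + 1 := ⟨d - 1, by omega⟩
    rw [pow_succ, Wmul_smul, x_vW_zero, smul_zero]
  · by_cases h : i + 1 < n
    · rw [vW, dif_pos h, ← map_smul]
      apply NSet_mk
      simp only [NSet, Set.mem_union, Set.mem_iUnion, Set.mem_singleton_iff]
      exact Or.inl (Or.inr ⟨⟨i + 1, h⟩, by simp, rfl⟩)
    · rw [vW_zero _ _ _ _ _ (by omega), smul_zero]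

lemma xm_vW (n d m : ℕ) : xA k p ^ (m + 1) • vW k p n d m = 0 := by
  induction m with
  | zero => rw [zero_add, pow_one, x_vW_zero]
  | succ m ih => rw [pow_succ, Wmul_smul, ← y_vW, smul_comm, ih, smul_zero]

lemma xpow_vW_eq_zero (n d i m : ℕ) (hd : 1 ≤ d) (h : ¬ (i < d ∧ i ≤ m ∧ m < n)) :
    xA k p ^ i • vW k p n d m = 0 := by
  by_cases h1 : i < d
  · by_cases h2 : i ≤ m
    · rw [vW_zero _ _ _ _ _ (by omega), smul_zero]
    · obtain ⟨e, rfl⟩ : ∃ e, i = e + (m + 1) := ⟨i - (m + 1), by omega⟩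
      rw [pow_add, Wmul_smul, xm_vW, smul_zero]
  · obtain ⟨e, rfl⟩ : ∃ e, i = e + d := ⟨i - d, by omega⟩
    rw [pow_add, Wmul_smul, xd_vW _ _ _ _ _ hd, smul_zero]

/-- Index set of the basis of `𝔪^j W`. -/
def idx (n d j : ℕ) : Finset (Σ _ : ℕ, ℕ) := (Finset.Ico j d).sigma fun i => Finset.Ico i n

lemma mem_idx (n d j : ℕ) (q : Σ _ : ℕ, ℕ) :
    q ∈ idx n d j ↔ (j ≤ q.1 ∧ q.1 < d) ∧ (q.1 ≤ q.2 ∧ q.2 < n) := by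
  simp [idx]

/-- The basis vectors of `𝔪^j W`. -/
def bW (n d j : ℕ) (q : idx n d j) : Wmod k p n d := xA k p ^ q.1.1 • vW k p n d q.1.2

lemma xv_mem_span (n d j : ℕ) (hd : 1 ≤ d) (i m : ℕ) (hj : j ≤ i) :
    xA k p ^ i • vW k p n d m ∈ Submodule.span k (Set.range (bW k p n d j)) := by
  by_cases h : i < d ∧ i ≤ m ∧ m < n
  · exact Submodule.subset_span ⟨⟨⟨i, m⟩, (mem_idx ..).2 ⟨⟨hj, h.1⟩, h.2⟩⟩, rfl⟩
  · rw [xpow_vW_eq_zero k p n d i m hd h]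
    exact Submodule.zero_mem _

lemma bW_span_top (n d : ℕ) (hd : 1 ≤ d) :
    Submodule.span k (Set.range (bW k p n d 0)) = ⊤ := by
  apply kspan_top k p _ (vW k p n d) (vW_span k p n d)
  · intro z hz
    induction hz using Submodule.span_induction with
    | mem z hz =>
      obtain ⟨q, rfl⟩ := hz
      rw [bW, ← Wmul_smul, ← pow_succ']
      exact xv_mem_span k p n d 0 hd _ _ (Nat.zero_le _)
    | zero => rw [smul_zero]; exact Submodule.zero_mem _
    | add a b _ _ ha hb => rw [smul_add]; exact Submodule.add_mem _ ha hb
    | smul c a _ ha => rw [smul_comm]; exact Submodule.smul_mem _ _ ha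
  · intro z hz
    induction hz using Submodule.span_induction with
    | mem z hz =>
      obtain ⟨q, rfl⟩ := hz
      rw [bW, smul_comm, y_vW, ← Wmul_smul, ← pow_succ]
      exact xv_mem_span k p n d 0 hd _ _ (Nat.zero_le _)
    | zero => rw [smul_zero]; exact Submodule.zero_mem _
    | add a b _ _ ha hb => rw [smul_add]; exact Submodule.add_mem _ ha hb
    | smul c a _ ha => rw [smul_comm]; exact Submodule.smul_mem _ _ ha
  · intro i
    have := xv_mem_span k p n d 0 hd 0 i le_rfl
    rwa [pow_zero, one_smul] at this

lemma finite_Wmod (n d : ℕ) (hd : 1 ≤ d) : Module.Finite k (Wmod k p n d) :=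
  by classical exact ⟨⟨Finset.univ.image (bW k p n d 0), by
    rw [Finset.coe_image, Finset.coe_univ, Set.image_univ, bW_span_top k p n d hd]⟩⟩

lemma bW_linInd (n d j : ℕ) (hdp : d ≤ p) : LinearIndependent k (bW k p n d j) := by
  classical
  rw [Fintype.linearIndependent_iff]
  intro g hg q
  have hq := (mem_idx n d j q.1).1 q.2
  have h1 := congrArg (cf k p n d hdp q.1.1 q.1.2 hq.1.2 hq.2.1 hq.2.2) hg
  rw [map_sum, map_zero, Finset.sum_eq_single q] at h1
  · rw [map_smul, bW, cf_apply _ _ _ _ _ _ _ _ _ _ _ _ hq.2.2, if_pos ⟨rfl, rfl⟩,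
      smul_eq_mul, mul_one] at h1
    exact h1
  · intro r _ hr
    have hr' := (mem_idx n d j r.1).1 r.2
    rw [map_smul, bW, cf_apply _ _ _ _ _ _ _ _ _ _ _ _ hr'.2.2, if_neg, smul_zero]
    rintro ⟨h2, h3⟩
    apply hr
    obtain ⟨⟨a, b⟩, ha⟩ := r
    obtain ⟨⟨a', b'⟩, ha'⟩ := q
    simp only at h2 h3
    subst h2 h3
    rfl
  · intro h
    exact absurd (Finset.mem_univ _) h

lemma EIP_W (n d : ℕ) : EIP k p (Wmod k p n d) :=
  EIP_of_gens k p (vW k p n d) n (vW_span k p n d) (x_vW_zero k p n d) (y_vW k p n d)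
    (vW_zero k p n d)

lemma mem_mpow (n d j : ℕ) (z : Wmod k p n d) :
    z ∈ mA k p ^ j • (⊤ : Submodule (Amod k p) (Wmod k p n d)) ↔ ∃ w, xA k p ^ j • w = z := by
  rw [← (EIP_W k p n d).range_pow k p (xA k p) (isPointOp_xA k p) j, LinearMap.mem_range]
  simp_rw [lsmul_pow_apply]

lemma mpow_eq_span (n d j : ℕ) (hd : 1 ≤ d) :
    (mA k p ^ j • (⊤ : Submodule (Amod k p) (Wmod k p n d))).restrictScalars k =
      Submodule.span k (Set.range (bW k p n d j)) := by
  apply le_antisymm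
  · intro z hz
    rw [Submodule.restrictScalars_mem, mem_mpow] at hz
    obtain ⟨w, rfl⟩ := hz
    have hw : w ∈ Submodule.span k (Set.range (bW k p n d 0)) := by
      rw [bW_span_top k p n d hd]; exact Submodule.mem_top
    induction hw using Submodule.span_induction with
    | mem z hz =>
      obtain ⟨q, rfl⟩ := hz
      rw [bW, ← Wmul_smul, ← pow_add]
      exact xv_mem_span k p n d j hd _ _ (Nat.le_add_right _ _)
    | zero => rw [smul_zero]; exact Submodule.zero_mem _
    | add a b _ _ ha hb => rw [smul_add]; exact Submodule.add_mem _ ha hb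
    | smul c a _ ha => rw [smul_comm]; exact Submodule.smul_mem _ _ ha
  · rw [Submodule.span_le]
    rintro _ ⟨q, rfl⟩
    have hq := (mem_idx n d j q.1).1 q.2
    rw [SetLike.mem_coe, Submodule.restrictScalars_mem, mem_mpow]
    refine ⟨xA k p ^ (q.1.1 - j) • vW k p n d q.1.2, ?_⟩
    rw [← Wmul_smul, ← pow_add, bW, Nat.add_sub_cancel' hq.1.1]

lemma finrank_mpow (n d j : ℕ) (hd : 1 ≤ d) (hdp : d ≤ p) :
    finrank k (mA k p ^ j • (⊤ : Submodule (Amod k p) (Wmod k p n d)) :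
      Submodule (Amod k p) (Wmod k p n d)) = ∑ i ∈ Finset.Ico j d, (n - i) := by
  have h1 : finrank k (mA k p ^ j • (⊤ : Submodule (Amod k p) (Wmod k p n d)) :
      Submodule (Amod k p) (Wmod k p n d)) =
    finrank k ((mA k p ^ j • (⊤ : Submodule (Amod k p) (Wmod k p n d))).restrictScalars k) := rfl
  rw [h1, mpow_eq_span k p n d j hd, finrank_span_eq_card (bW_linInd k p n d j hdp),
    Fintype.card_coe, idx, Finset.card_sigma]
  simp

lemma cf_mpow (n d j : ℕ) (hd : 1 ≤ d) (hdp : d ≤ p) (i m : ℕ) (hi : i < d) (him : i ≤ m)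
    (hm : m < n) (hij : i < j) (z : Wmod k p n d)
    (hz : z ∈ mA k p ^ j • (⊤ : Submodule (Amod k p) (Wmod k p n d))) :
    cf k p n d hdp i m hi him hm z = 0 := by
  have hz' : z ∈ (mA k p ^ j • (⊤ : Submodule (Amod k p) (Wmod k p n d))).restrictScalars k := hz
  rw [mpow_eq_span k p n d j hd] at hz'
  clear hz
  induction hz' using Submodule.span_induction with
  | mem z hz =>
    obtain ⟨q, rfl⟩ := hz
    have hq := (mem_idx n d j q.1).1 q.2
    rw [bW, cf_apply _ _ _ _ _ _ _ _ _ _ _ _ hq.2.2, if_neg]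
    omega
  | zero => rw [map_zero]
  | add a b _ _ ha hb => rw [map_add, ha, hb, add_zero]
  | smul c a _ ha => rw [map_smul, ha, smul_zero]

lemma mA_pow_one : mA k p ^ 1 = mA k p := Submodule.pow_one _

lemma decomp (n d : ℕ) (hd : 1 ≤ d) (z : Wmod k p n d) : ∃ g : ℕ → k,
    z - ∑ m ∈ Finset.range n, g m • vW k p n d m ∈
      mA k p • (⊤ : Submodule (Amod k p) (Wmod k p n d)) := by
  have hz : z ∈ Submodule.span k (Set.range (bW k p n d 0)) := by
    rw [bW_span_top k p n d hd]; exact Submodule.mem_top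
  induction hz using Submodule.span_induction with
  | mem z hz =>
    obtain ⟨⟨⟨i, m⟩, hq⟩, rfl⟩ := hz
    rw [mem_idx] at hq
    simp only at hq
    rcases i with _ | i
    · refine ⟨fun a => if a = m then 1 else 0, ?_⟩
      simp only [ite_smul, one_smul, zero_smul, Finset.sum_ite_eq', Finset.mem_range, hq.2.2,
        if_true, bW, pow_zero, sub_self]
      exact Submodule.zero_mem _
    · refine ⟨0, ?_⟩
      simp only [Pi.zero_apply, zero_smul, Finset.sum_const_zero, sub_zero, bW]
      rw [pow_succ', Wmul_smul]
      exact Submodule.smul_mem_smul (xA_mem k p) Submodule.mem_top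
  | zero => exact ⟨0, by simp⟩
  | add a b _ _ ha hb =>
    obtain ⟨g, hg⟩ := ha
    obtain ⟨h, hh⟩ := hb
    refine ⟨g + h, ?_⟩
    have := Submodule.add_mem _ hg hh
    simp only [Pi.add_apply, add_smul, Finset.sum_add_distrib]
    rwa [add_sub_add_comm]
  | smul c a _ ha =>
    obtain ⟨g, hg⟩ := ha
    refine ⟨c • g, ?_⟩
    have := ((mA k p • (⊤ : Submodule (Amod k p) (Wmod k p n d))).restrictScalars k).smul_mem c hg
    rw [smul_sub, Finset.smul_sum] at this
    simp only [Pi.smul_apply, smul_assoc]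
    exact this

lemma starW (n d : ℕ) (hd : 3 ≤ d) (hdp : d ≤ p) (hn : 0 < n) (z : Wmod k p n d)
    (hz : xA k p • z ∈ mA k p ^ 2 • (⊤ : Submodule (Amod k p) (Wmod k p n d))) :
    ∃ c : k, z - c • vW k p n d 0 ∈ mA k p • (⊤ : Submodule (Amod k p) (Wmod k p n d)) := by
  obtain ⟨g, hg⟩ := decomp k p n d (by omega) z
  have h1 : ∑ m ∈ Finset.range n, g m • (xA k p • vW k p n d m) ∈
      mA k p ^ 2 • (⊤ : Submodule (Amod k p) (Wmod k p n d)) := by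
    have h2 := Submodule.smul_mem_smul (xA_mem k p) hg
    rw [← Submodule.mul_smul, ← mA_pow_two] at h2
    have h3 := Submodule.sub_mem _ hz h2
    rw [smul_sub, sub_sub_cancel, Finset.smul_sum] at h3
    simpa only [smul_comm (xA k p)] using h3
  have h2 : ∀ m, 0 < m → m < n → g m = 0 := by
    intro m hm0 hm
    have h3 := cf_mpow k p n d 2 (by omega) hdp 1 m (by omega) hm0 hm (by omega) _ h1
    rw [map_sum, Finset.sum_eq_single m] at h3
    · rw [map_smul, ← pow_one (xA k p), cf_apply _ _ _ _ _ _ _ _ _ _ _ _ hm, if_pos ⟨rfl, rfl⟩,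
        smul_eq_mul, mul_one] at h3
      exact h3
    · intro b hb hbm
      rw [Finset.mem_range] at hb
      rw [map_smul, ← pow_one (xA k p), cf_apply _ _ _ _ _ _ _ _ _ _ _ _ hb, if_neg, smul_zero]
      tauto
    · intro h
      exact absurd (Finset.mem_range.2 hm) h
  refine ⟨g 0, ?_⟩
  rw [Finset.sum_eq_single 0] at hg
  · exact hg
  · intro b hb hb0
    rw [h2 b (by omega) (Finset.mem_range.1 hb), zero_smul]
  · intro h
    exact absurd (Finset.mem_range.2 hn) h

lemma v0_notMem (n d : ℕ) (hd : 1 ≤ d) (hdp : d ≤ p) (hn : 0 < n) :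
    vW k p n d 0 ∉ mA k p • (⊤ : Submodule (Amod k p) (Wmod k p n d)) := by
  intro h
  rw [← mA_pow_one] at h
  have h1 := cf_mpow k p n d 1 hd hdp 0 0 (by omega) le_rfl hn (by omega) _ h
  have h2 := cf_apply k p n d hdp 0 0 (by omega) le_rfl hn 0 0 hn
  rw [pow_zero, one_smul, h1] at h2
  simp at h2

/-! ### Quotients of `W` -/

section quot

variable (n d : ℕ) (U : Submodule (Amod k p) (Wmod k p n d))

lemma mpow_quot (j : ℕ) :
    mA k p ^ j • (⊤ : Submodule (Amod k p) (Wmod k p n d ⧸ U)) =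
      Submodule.map U.mkQ (mA k p ^ j • (⊤ : Submodule (Amod k p) (Wmod k p n d))) := by
  rw [Submodule.map_smul'', Submodule.map_top, Submodule.range_mkQ]

lemma mem_of_mkQ_mem (j : ℕ)
    (hU : U ≤ mA k p ^ j • (⊤ : Submodule (Amod k p) (Wmod k p n d))) (z : Wmod k p n d)
    (hz : U.mkQ z ∈ mA k p ^ j • (⊤ : Submodule (Amod k p) (Wmod k p n d ⧸ U))) :
    z ∈ mA k p ^ j • (⊤ : Submodule (Amod k p) (Wmod k p n d)) := by
  rw [mpow_quot] at hz
  obtain ⟨w, hw, hwz⟩ := hz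
  rw [Submodule.mkQ_apply, Submodule.mkQ_apply, Submodule.Quotient.eq] at hwz
  have := Submodule.sub_mem _ hw (hU hwz)
  rwa [sub_sub_cancel] at this

lemma mpow_anti {M : Type} [AddCommGroup M] [Module (Amod k p) M] {i j : ℕ} (h : i ≤ j) :
    mA k p ^ j • (⊤ : Submodule (Amod k p) M) ≤ mA k p ^ i • (⊤ : Submodule (Amod k p) M) := by
  induction h with
  | refl => exact le_rfl
  | step _ ih =>
    refine le_trans ?_ ih
    rw [mA_pow_succ, Submodule.mul_smul]
    exact Submodule.smul_mono le_rfl le_top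

lemma span_quot : Submodule.span (Amod k p) (Set.range fun i => U.mkQ (vW k p n d i)) = ⊤ := by
  have : (Set.range fun i => U.mkQ (vW k p n d i)) = U.mkQ '' Set.range (vW k p n d) :=
    Set.range_comp _ _
  rw [this, Submodule.span_image, vW_span, Submodule.map_top, Submodule.range_mkQ]

lemma EIP_quot : EIP k p (Wmod k p n d ⧸ U) := by
  refine EIP_of_gens k p (fun i => U.mkQ (vW k p n d i)) n (span_quot k p n d U) ?_ ?_ ?_
  · show xA k p • U.mkQ (vW k p n d 0) = 0
    rw [← map_smul, x_vW_zero, map_zero]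
  · intro i
    show yA k p • U.mkQ (vW k p n d i) = xA k p • U.mkQ (vW k p n d (i + 1))
    rw [← map_smul, ← map_smul, y_vW]
  · intro i hi
    show U.mkQ (vW k p n d i) = 0
    rw [vW_zero _ _ _ _ _ hi, map_zero]

lemma mpow_d (hd : 1 ≤ d) : mA k p ^ d • (⊤ : Submodule (Amod k p) (Wmod k p n d)) = ⊥ := by
  rw [eq_bot_iff]
  intro z hz
  have hz' : z ∈ (mA k p ^ d • (⊤ : Submodule (Amod k p) (Wmod k p n d))).restrictScalars k := hz
  rw [mpow_eq_span k p n d d hd] at hz'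
  have : IsEmpty (idx n d d) := by
    rw [Finset.isEmpty_coe_sort]
    simp [idx]
  rw [Set.range_eq_empty, Submodule.span_empty] at hz'
  exact hz'

lemma mpow_d_quot (hd : 1 ≤ d) : mA k p ^ d • (⊤ : Submodule (Amod k p) (Wmod k p n d ⧸ U)) = ⊥ := by
  rw [mpow_quot, mpow_d k p n d hd, Submodule.map_bot]

lemma indec_quot (hd : 3 ≤ d) (hdp : d ≤ p) (hn : d ≤ n)
    (hU : U ≤ mA k p ^ (d - 1) • (⊤ : Submodule (Amod k p) (Wmod k p n d))) :
    IsIndecomposableMod k p (Wmod k p n d ⧸ U) := by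
  refine indec_of k p (fun i => U.mkQ (vW k p n d i)) d (span_quot k p n d U) ?_ ?_
    (mpow_d_quot k p n d U (by omega)) ?_ ?_
  · show xA k p • U.mkQ (vW k p n d 0) = 0
    rw [← map_smul, x_vW_zero, map_zero]
  · intro i
    show yA k p • U.mkQ (vW k p n d i) = xA k p • U.mkQ (vW k p n d (i + 1))
    rw [← map_smul, ← map_smul, y_vW]
  · intro z hz
    obtain ⟨z, rfl⟩ := U.mkQ_surjective z
    rw [← map_smul] at hz
    have h1 := mem_of_mkQ_mem k p n d U 2 (hU.trans (mpow_anti k p (by omega))) _ hz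
    obtain ⟨c, hc⟩ := starW k p n d hd hdp (by omega) z h1
    refine ⟨c, ?_⟩
    rw [← mA_pow_one] at hc ⊢
    rw [mpow_quot]
    exact ⟨_, hc, rfl⟩
  · intro h
    rw [← mA_pow_one] at h
    have h1 := mem_of_mkQ_mem k p n d U 1 (hU.trans (mpow_anti k p (by omega))) _ h
    rw [mA_pow_one] at h1
    exact v0_notMem k p n d (by omega) hdp (by omega) h1

lemma finrank_quot (hd : 1 ≤ d) (hdp : d ≤ p) (j : ℕ)
    (hU : U ≤ mA k p ^ j • (⊤ : Submodule (Amod k p) (Wmod k p n d))) :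
    finrank k (mA k p ^ j • (⊤ : Submodule (Amod k p) (Wmod k p n d ⧸ U)) :
      Submodule (Amod k p) (Wmod k p n d ⧸ U)) + finrank k U = ∑ i ∈ Finset.Ico j d, (n - i) := by
  haveI := finite_Wmod k p n d hd
  rw [← finrank_mpow k p n d j hd hdp]
  set N := mA k p ^ j • (⊤ : Submodule (Amod k p) (Wmod k p n d)) with hN
  let f : N →ₗ[Amod k p] (Wmod k p n d ⧸ U) := U.mkQ.domRestrict N
  haveI : Module.Finite k N :=
    inferInstanceAs (Module.Finite k (N.restrictScalars k))
  have h1 := LinearMap.finrank_range_add_finrank_ker (f.restrictScalars k)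
  have h2 : LinearMap.range f = mA k p ^ j • (⊤ : Submodule (Amod k p) (Wmod k p n d ⧸ U)) := by
    rw [mpow_quot, LinearMap.range_domRestrict]
  have h3 : LinearMap.ker f = U.comap N.subtype := by
    rw [LinearMap.ker_domRestrict, Submodule.ker_mkQ]
  have e : (U.comap N.subtype) ≃ₗ[Amod k p] U := Submodule.comapSubtypeEquivOfLe hU
  have h4 : finrank k (U.comap N.subtype) = finrank k U := (e.restrictScalars k).finrank_eq
  rw [← h2, ← h4, ← h3]
  exact h1

end quot

lemma jordan_sum (n d p r j : ℕ) (hd : 3 ≤ d) (hdp : d ≤ p) (hn : d ≤ n) (hr : r ≤ n - d + 1)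
    (hj : j ≤ d - 1) :
    (∑ i ∈ Finset.Icc (j + 1) p, (i - j) * (if 1 ≤ i ∧ i ≤ d - 2 then 1
        else if i = d - 1 then r + 1
        else if i = d then n - d + 1 - r
        else 0)) + r = ∑ i ∈ Finset.Ico j d, (n - i) := by
  obtain ⟨e, rfl⟩ : ∃ e, d = e + 1 := ⟨d - 1, by omega⟩
  obtain ⟨N, rfl⟩ : ∃ N, n = e + N + r := ⟨n - e - r, by omega⟩
  have hje : j ≤ e := by omega
  have h1 : Finset.Icc (j + 1) p = Finset.Ico (j + 1) (p + 1) := by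
    ext a
    rw [Finset.mem_Icc, Finset.mem_Ico]
    omega
  rw [h1, ← Finset.sum_Ico_consecutive _ (show j + 1 ≤ e + 2 by omega) (show e + 2 ≤ p + 1 by omega)]
  have h2 : ∑ i ∈ Finset.Ico (e + 2) (p + 1), (i - j) * (if 1 ≤ i ∧ i ≤ e + 1 - 2 then 1
        else if i = e + 1 - 1 then r + 1
        else if i = e + 1 then e + N + r - (e + 1) + 1 - r
        else 0) = 0 := by
    refine Finset.sum_eq_zero fun i hi => ?_
    rw [Finset.mem_Ico] at hi
    rw [if_neg (by omega), if_neg (by omega), if_neg (by omega), mul_zero]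
  rw [h2, add_zero, Finset.sum_Ico_succ_top (show j + 1 ≤ e + 1 by omega)]
  rw [if_neg (by omega), if_neg (by omega), if_pos rfl, show e + N + r - (e + 1) + 1 - r = N by omega]
  rcases Nat.lt_or_ge j e with hlt | hge
  · rw [Finset.sum_Ico_succ_top (show j + 1 ≤ e by omega)]
    rw [if_neg (by omega), if_pos (by omega)]
    have h3 : ∑ i ∈ Finset.Ico (j + 1) e, (i - j) * (if 1 ≤ i ∧ i ≤ e + 1 - 2 then 1
        else if i = e + 1 - 1 then r + 1
        else if i = e + 1 then N
        else 0) = ∑ i ∈ Finset.Ico (j + 1) e, (i - j) := by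
      refine Finset.sum_congr rfl fun i hi => ?_
      rw [Finset.mem_Ico] at hi
      rw [if_pos (by omega), mul_one]
    have h4 : ∀ t : ℕ, ∑ i ∈ Finset.Ico (j + 1) (j + t + 1), (i - j) = ∑ s ∈ Finset.range (t + 1), s := by
      intro t
      rw [Finset.sum_Ico_eq_sum_range, Finset.sum_range_succ' _ t, add_zero,
        show j + t + 1 - (j + 1) = t by omega]
      exact Finset.sum_congr rfl fun i _ => by omega
    have h5 : ∀ t : ℕ, j + t ≤ e + N + r →
        ∑ i ∈ Finset.Ico j (j + t + 1), (e + N + r - i) + ∑ s ∈ Finset.range (t + 1), s =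
          (t + 1) * (e + N + r - j) := by
      intro t
      induction t with
      | zero => intro _; simp
      | succ t ih =>
        intro ht
        rw [Finset.sum_Ico_succ_top (by omega), Finset.sum_range_succ, ← add_assoc j t 1]
        have := ih (by omega)
        have h6 : e + N + r - (j + t + 1) + (t + 1) = e + N + r - j := by omega
        rw [add_mul (t + 1) 1, one_mul, ← this, ← h6]
        ring
    obtain ⟨t, rfl⟩ : ∃ t, e = j + t + 1 := ⟨e - j - 1, by omega⟩
    rw [h3, h4]
    have h7 := h5 (t + 1) (by omega)
    have h8 := Finset.sum_range_succ (fun s => s) (t + 1)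
    have h9 := Finset.sum_range_id_mul_two (t + 1)
    rw [show j + t + 1 + N + r - j = t + 1 + N + r by omega] at h7
    rw [show j + (t + 1) + 1 = j + t + 1 + 1 by ring, h8] at h7
    rw [show j + t + 1 - j = t + 1 by omega, show j + t + 1 + 1 - j = t + 2 by omega]
    simp only [Nat.add_sub_cancel] at h9
    nlinarith
  · obtain rfl : j = e := by omega
    simp
    omega

/-- for `p ≥ 3`, `3 ≤ d ≤ p`, `n ≥ d` and `U` a subspace of `𝔪^{d−1}·W_{n,d}`
(automatically an `A`-submodule), the quotient `W_{n,d}/U` is an indecomposable equal images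
module of constant Jordan type `⊕_{i=1}^{d−2}[i] ⊕ (dim U + 1)[d−1] ⊕ (n−d+1−dim U)[d]`. -/
theorem Wquot_indecomposable_EIP_constantJordanType
    [IsAlgClosed k] [Fact p.Prime] [CharP k p] (hp3 : 3 ≤ p)
    (d n : ℕ) (hd3 : 3 ≤ d) (hdp : d ≤ p) (hn : d ≤ n)
    (U : Submodule (Amod k p) (Wmod k p n d))
    (hU : U ≤ (mA k p) ^ (d - 1) • (⊤ : Submodule (Amod k p) (Wmod k p n d))) :
    IsIndecomposableMod k p (Wmod k p n d ⧸ U) ∧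
    EIP k p (Wmod k p n d ⧸ U) ∧
    ConstantJordanType k p
      (fun i => if 1 ≤ i ∧ i ≤ d - 2 then 1
        else if i = d - 1 then finrank k (↥U) + 1
        else if i = d then n - d + 1 - finrank k (↥U)
        else 0)
      (Wmod k p n d ⧸ U) := by
  have hr : finrank k U ≤ n - d + 1 := by
    have := finrank_quot k p n d U (by omega) hdp (d - 1) hU
    have h2 : Finset.Ico (d - 1) d = {d - 1} := by
      ext; simp; omega
    rw [h2, Finset.sum_singleton] at this
    omega
  have hE := EIP_quot k p n d U
  have key : ∀ j, j ≤ d - 1 →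
      finrank k (mA k p ^ j • (⊤ : Submodule (Amod k p) (Wmod k p n d ⧸ U)) :
        Submodule (Amod k p) (Wmod k p n d ⧸ U)) =
      ∑ i ∈ Finset.Icc (j + 1) p, (i - j) * (if 1 ≤ i ∧ i ≤ d - 2 then 1
        else if i = d - 1 then finrank k U + 1
        else if i = d then n - d + 1 - finrank k U
        else 0) := by
    intro j hj
    have h1 := finrank_quot k p n d U (by omega) hdp j (hU.trans (mpow_anti k p hj))
    have h2 := jordan_sum n d p (finrank k U) j hd3 hdp hn hr hj
    omega
  refine ⟨indec_quot k p n d U hd3 hdp hn hU, hE, ?_, ?_⟩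
  · have h1 := key 0 (Nat.zero_le _)
    simp only [Nat.sub_zero, zero_add] at h1
    rw [← h1]
    have h2 : mA k p ^ 0 • (⊤ : Submodule (Amod k p) (Wmod k p n d ⧸ U)) = ⊤ := by
      rw [mpow_quot]
      have : mA k p ^ 0 • (⊤ : Submodule (Amod k p) (Wmod k p n d)) = ⊤ := by simp
      rw [this, Submodule.map_top, Submodule.range_mkQ]
    rw [h2]
    exact (finrank_top k (Wmod k p n d ⧸ U)).symm
  · intro u hu j hj1 hj2
    rw [hE.range_pow k p u hu j]
    by_cases hj : j ≤ d - 1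
    · exact key j hj
    · have h1 : mA k p ^ j • (⊤ : Submodule (Amod k p) (Wmod k p n d ⧸ U)) = ⊥ := by
        rw [eq_bot_iff, ← mpow_d_quot k p n d U (by omega)]
        exact mpow_anti k p (by omega)
      rw [h1, Finset.sum_eq_zero]
      · exact finrank_bot k (Wmod k p n d ⧸ U)
      · intro i hi
        rw [Finset.mem_Icc] at hi
        beta_reduce
        rw [if_neg (by omega), if_neg (by omega), if_neg (by omega), mul_zero]

end
end

section
/- Let M be a nonzero A-module lying in EIP_{p−1} (i.e., M has the equal images property and 𝔪^{p−1}M = 0). Then dim_k Ext_A^{2n}(M, M) ≥ n + 1 for every integer n ≥ 0. -/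
open MvPolynomial Module

set_option maxHeartbeats 1000000
set_option synthInstance.maxHeartbeats 400000

noncomputable section

variable (k : Type) [Field k] (p : ℕ)

lemma prodPoly (p : ℕ) [Fact p.Prime] :
    (∏ i ∈ Finset.range (p - 1), (Polynomial.X + Polynomial.C (((i + 1 : ℕ)) : ZMod p)))
      = Polynomial.X ^ (p - 1) - 1 := by
  have hp : 1 < p := (Fact.out : p.Prime).one_lt
  have hm1 : (∏ i ∈ Finset.range (p - 1),
      (Polynomial.X + Polynomial.C (((i + 1 : ℕ)) : ZMod p))).Monic :=
    Polynomial.monic_prod_of_monic _ _ fun i _ => Polynomial.monic_X_add_C _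
  have hd1 : (∏ i ∈ Finset.range (p - 1),
      (Polynomial.X + Polynomial.C (((i + 1 : ℕ)) : ZMod p))).degree = ((p - 1 : ℕ) : WithBot ℕ) := by
    rw [Polynomial.degree_prod]
    simp_rw [Polynomial.degree_X_add_C]
    simp
  have hd2 : (Polynomial.X ^ (p - 1) - 1 : Polynomial (ZMod p)).degree = ((p - 1 : ℕ) : WithBot ℕ) :=
    Polynomial.degree_X_pow_sub_C (by omega) 1
  have hm2 : (Polynomial.X ^ (p - 1) - 1 : Polynomial (ZMod p)).Monic :=
    Polynomial.monic_X_pow_sub_C 1 (by omega)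
  apply Polynomial.eq_of_degree_sub_lt_of_eval_finset_eq (Finset.univ.erase (0 : ZMod p))
  · rw [Finset.card_erase_of_mem (Finset.mem_univ _), Finset.card_univ, ZMod.card, ← hd1]
    apply Polynomial.degree_sub_lt_left (by rw [hd1, hd2]) hm1.ne_zero
    rw [hm1.leadingCoeff, hm2.leadingCoeff]
  · intro a ha
    have ha : a ≠ 0 := Finset.ne_of_mem_erase ha
    have hv : (-a).val ≠ 0 := by
      rw [Ne, ZMod.val_eq_zero]; simpa using ha
    have hl := ZMod.val_lt (-a)
    rw [Polynomial.eval_prod]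
    simp only [Polynomial.eval_sub, Polynomial.eval_pow, Polynomial.eval_X, Polynomial.eval_one,
      ZMod.pow_card_sub_one_eq_one ha, sub_self]
    apply Finset.prod_eq_zero (i := (-a).val - 1) (Finset.mem_range.2 (by omega))
    rw [show (-a).val - 1 + 1 = (-a).val by omega]
    simp

lemma weylAux {R : Type*} [Ring R] (X D : R) (h : D * X = X * D + 1) (j : ℕ) :
    (X * D) * X ^ j = X ^ j * (X * D + j) := by
  induction j with
  | zero => simp
  | succ j ih =>
    rw [pow_succ, ← mul_assoc, ih, mul_assoc, mul_assoc]
    congr 1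
    push_cast
    simp only [add_mul, mul_assoc, h, mul_add]
    rw [(Nat.cast_commute j X).eq]
    simp; abel

lemma weylAux' {R : Type*} [Ring R] (X D : R) (h : D * X = X * D + 1) (j : ℕ) :
    (D * X) * D ^ j = D ^ j * (D * X - j) := by
  induction j with
  | zero => simp
  | succ j ih =>
    rw [pow_succ, ← mul_assoc, ih, mul_assoc, mul_assoc]
    congr 1
    push_cast
    have h' : X * D = D * X - 1 := by rw [h]; simp
    simp only [sub_mul, mul_assoc, h', mul_sub, mul_add]
    rw [(Nat.cast_commute j D).eq]
    simp; abel

lemma weylDX {R : Type*} [Ring R] (p : ℕ) [Fact p.Prime] [Algebra (ZMod p) R]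
    (X D : R) (h : D * X = X * D + 1) (j : ℕ) :
    D ^ j * X ^ j = Polynomial.aeval (X * D)
      (∏ i ∈ Finset.range j, (Polynomial.X + Polynomial.C (((i + 1 : ℕ)) : ZMod p))) := by
  induction j with
  | zero => simp
  | succ j ih =>
    rw [Finset.prod_range_succ, map_mul, ← ih, pow_succ, pow_succ']
    rw [show D ^ j * D * (X * X ^ j) = D ^ j * (D * X * X ^ j) by simp only [mul_assoc], h, add_mul,
      weylAux X D h]
    simp only [map_add, Polynomial.aeval_X, map_natCast, mul_assoc]
    push_cast
    rw [← add_assoc, one_mul]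
    simp only [mul_add, mul_one]

lemma weylXD {R : Type*} [Ring R] (p : ℕ) [Fact p.Prime] [Algebra (ZMod p) R]
    (X D : R) (h : D * X = X * D + 1) (j : ℕ) :
    (-X) ^ j * D ^ j = Polynomial.aeval (-(D * X))
      (∏ i ∈ Finset.range j, (Polynomial.X + Polynomial.C (((i + 1 : ℕ)) : ZMod p))) := by
  have := weylDX p D (-X) (by rw [mul_neg, h]; simp) j
  rw [this, mul_neg]

lemma weyl1 {R : Type*} [Ring R] (p : ℕ) [Fact p.Prime] [Algebra (ZMod p) R]
    (X D : R) (h : D * X = X * D + 1) :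
    X * (D * (X * D) ^ (p - 2)) + (-D ^ (p - 1)) * X ^ (p - 1) = 1 := by
  have hp : 1 < p := (Fact.out : p.Prime).one_lt
  have := weylDX p X D h (p - 1)
  rw [prodPoly] at this
  rw [neg_mul, this, ← mul_assoc, ← pow_succ', show p - 2 + 1 = p - 1 by omega]
  simp

lemma weyl2 {R : Type*} [Ring R] (p : ℕ) [Fact p.Prime] [Algebra (ZMod p) R]
    (X D : R) (h : D * X = X * D + 1) :
    (D * (X * D) ^ (p - 2)) * X + X ^ (p - 1) * (-D ^ (p - 1)) = 1 := by
  have hp : 1 < p := (Fact.out : p.Prime).one_lt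
  have := weylXD p X D h (p - 1)
  rw [prodPoly] at this
  have hs : ∀ r : R, (-r) ^ (p - 1) = r ^ (p - 1) := by
    intro r
    rcases (Fact.out : p.Prime).eq_two_or_odd' with rfl | ho
    · have : (2 : R) = 0 := by
        have := congrArg (algebraMap (ZMod 2) R) (ZMod.natCast_self 2)
        rw [map_natCast, map_zero] at this
        exact_mod_cast this
      have : r + r = 0 := by rw [← two_mul, this, zero_mul]
      simp [neg_eq_of_add_eq_zero_left this]
    · exact (Nat.Odd.sub_odd ho odd_one).neg_pow r
  simp only [map_sub, map_pow, Polynomial.aeval_X, map_one, hs] at this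
  rw [mul_neg, this]
  have h3 : ∀ j, D * (X * D) ^ j * X = (D * X) ^ (j + 1) := by
    intro j
    induction j with
    | zero => simp
    | succ j ih => rw [pow_succ' (X * D), pow_succ' (D * X), ← ih]; simp only [mul_assoc]
  rw [h3, show p - 2 + 1 = p - 1 by omega]; simp

/-- geometric sum in characteristic p -/
lemma geomChar {R : Type*} [Ring R] (p : ℕ) [Fact p.Prime] [Algebra (ZMod p) R] (a b : R)
    (hab : Commute a b) :
    ∑ i ∈ Finset.range p, a ^ i * b ^ (p - 1 - i) = (a - b) ^ (p - 1) := by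
  have hp : 1 < p := (Fact.out : p.Prime).one_lt
  have key : ∑ i ∈ Finset.range p, (Polynomial.X : Polynomial (Polynomial (ZMod p))) ^ i
      * (Polynomial.C Polynomial.X) ^ (p - 1 - i)
        = (Polynomial.X - Polynomial.C Polynomial.X) ^ (p - 1) := by
    have hne : (Polynomial.X - Polynomial.C Polynomial.X : Polynomial (Polynomial (ZMod p))) ≠ 0 :=
      Polynomial.X_sub_C_ne_zero _
    apply mul_right_cancel₀ hne
    rw [geom_sum₂_mul, ← pow_succ, show p - 1 + 1 = p by omega, sub_pow_char]
  have hc : ∀ f : Polynomial (ZMod p), Commute ((Polynomial.aeval b).toRingHom f) a := by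
    intro f
    induction f using Polynomial.induction_on' with
    | add f g hf hg => rw [map_add]; exact hf.add_left hg
    | monomial n c =>
      rw [← Polynomial.C_mul_X_pow_eq_monomial]
      simp only [AlgHom.toRingHom_eq_coe, RingHom.coe_coe, map_mul, Polynomial.aeval_C, map_pow,
        Polynomial.aeval_X]
      exact Commute.mul_left (Algebra.commutes c a) (hab.symm.pow_left n)
  obtain ⟨φ, hφX, hφC⟩ : ∃ φ : Polynomial (Polynomial (ZMod p)) →+* R,
      φ Polynomial.X = a ∧ φ (Polynomial.C Polynomial.X) = b :=
    ⟨Polynomial.eval₂RingHom' (Polynomial.aeval b).toRingHom a hc, by simp, by simp⟩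
  have := congrArg φ key
  simpa [hφX, hφC] using this

lemma subPowChar {R : Type*} [Ring R] (p : ℕ) [Fact p.Prime] [Algebra (ZMod p) R] (a b : R)
    (hab : Commute a b) : (a - b) ^ p = a ^ p - b ^ p := by
  have hp : 1 < p := (Fact.out : p.Prime).one_lt
  rw [← hab.geom_sum₂_mul, geomChar p a b hab, ← pow_succ, show p - 1 + 1 = p by omega]

section cplx

variable {A F : Type} [CommRing A] [AddCommGroup F] [Module A F]

/-- alternating operators -/
def altOp (p : ℕ) (X : Module.End A F) (a : ℕ) : Module.End A F :=
  if Even a then X ^ (p - 1) else X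

/-- differential of the total complex -/
def totD (p : ℕ) (X Y : Module.End A F) (m : ℕ) :
    (Fin (m + 2) → F) →ₗ[A] (Fin (m + 1) → F) :=
  LinearMap.pi fun i =>
    altOp p X (i + 1) ∘ₗ LinearMap.proj i.succ
      + (-1 : A) ^ (i : ℕ) • (altOp p Y (m + 1 - i) ∘ₗ LinearMap.proj i.castSucc)

lemma totD_apply (p : ℕ) (X Y : Module.End A F) (m : ℕ) (e : Fin (m + 2) → F) (i : Fin (m + 1)) :
    totD p X Y m e i = altOp p X (i + 1) (e i.succ)
      + (-1 : A) ^ (i : ℕ) • altOp p Y (m + 1 - i) (e i.castSucc) := rfl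

lemma altOp_sq (p : ℕ) (hp : 0 < p) (X : Module.End A F) (hX : X ^ p = 0) (a : ℕ) (e : F) :
    altOp p X a (altOp p X (a + 1) e) = 0 := by
  have h1 : X ^ (p - 1) * X = 0 := by rw [← pow_succ, Nat.sub_add_cancel hp, hX]
  have h2 : X * X ^ (p - 1) = 0 := by rw [← pow_succ', Nat.sub_add_cancel hp, hX]
  rw [← Module.End.mul_apply]
  unfold altOp
  by_cases h : Even a <;> simp [h, Nat.even_add_one, h1, h2]

lemma altOp_comm (p : ℕ) (X Y : Module.End A F) (hXY : Commute X Y) (a b : ℕ) (e : F) :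
    altOp p X a (altOp p Y b e) = altOp p Y b (altOp p X a e) := by
  rw [← Module.End.mul_apply, ← Module.End.mul_apply]
  congr 1
  change Commute _ _
  unfold altOp
  split_ifs
  · exact hXY.pow_pow _ _
  · exact hXY.pow_left _
  · exact hXY.pow_right _
  · exact hXY

lemma totD_sq (p : ℕ) (hp : 0 < p) (X Y : Module.End A F) (hX : X ^ p = 0) (hY : Y ^ p = 0)
    (hXY : Commute X Y) (m : ℕ) (e : Fin (m + 3) → F) :
    totD p X Y m (totD p X Y (m + 1) e) = 0 := by
  ext i
  simp only [totD_apply, map_add, map_smul, Fin.val_succ, Fin.val_castSucc, Pi.zero_apply, smul_add]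
  have hi : (i : ℕ) ≤ m := by omega
  rw [altOp_sq p hp X hX, show m + 1 + 1 - (i : ℕ) = (m + 1 - i) + 1 by omega,
    altOp_sq p hp Y hY, show m + 1 + 1 - ((i : ℕ) + 1) = m + 1 - i by omega,
    altOp_comm p X Y hXY, Fin.succ_castSucc, pow_succ]
  simp

lemma totD_exact (p : ℕ) (X Y : Module.End A F) (S T S' T' : F →+ F)
    (h1 : ∀ e, X (S e) + T ((X ^ (p - 1)) e) = e)
    (h2 : ∀ e, S (X e) + (X ^ (p - 1)) (T e) = e)
    (h1' : ∀ e, Y (S' e) + T' ((Y ^ (p - 1)) e) = e)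
    (h2' : ∀ e, S' (Y e) + (Y ^ (p - 1)) (T' e) = e)
    (hp : 0 < p) (hX : X ^ p = 0) (hXY : Commute X Y)
    (hS : ∀ e, S (Y e) = Y (S e)) (hT : ∀ e, T (Y e) = Y (T e))
    (m : ℕ) (e : Fin (m + 2) → F) (he : totD p X Y m e = 0) :
    ∃ e', totD p X Y (m + 1) e' = e := by
  let s : ℕ → F →+ F := fun a => if Even a then S else T
  let t : ℕ → F →+ F := fun a => if Even a then S' else T'
  have hs : ∀ a e, altOp p X (a + 2) (s (a + 1) e) + s a (altOp p X (a + 1) e) = e := by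
    intro a e
    by_cases h : Even a
    · simp only [altOp, s, Nat.even_add_one, h, not_true_eq_false, if_true, if_false, not_false_eq_true]
      rw [add_comm]; exact h2 e
    · simp only [altOp, s, Nat.even_add_one, h, not_true_eq_false, if_true, if_false, not_false_eq_true]
      exact h1 e
  have ht : ∀ a e, altOp p Y (a + 2) (t (a + 1) e) + t a (altOp p Y (a + 1) e) = e := by
    intro a e
    by_cases h : Even a
    · simp only [altOp, t, Nat.even_add_one, h, not_true_eq_false, if_true, if_false, not_false_eq_true]
      rw [add_comm]; exact h2' e
    · simp only [altOp, t, Nat.even_add_one, h, not_true_eq_false, if_true, if_false, not_false_eq_true]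
      exact h1' e
  have hSp : ∀ j e, S ((Y ^ j) e) = (Y ^ j) (S e) := by
    intro j
    induction j with
    | zero => simp
    | succ j ih => intro e; rw [pow_succ, Module.End.mul_apply, ih, hS, Module.End.mul_apply]
  have hTp : ∀ j e, T ((Y ^ j) e) = (Y ^ j) (T e) := by
    intro j
    induction j with
    | zero => simp
    | succ j ih => intro e; rw [pow_succ, Module.End.mul_apply, ih, hT, Module.End.mul_apply]
  have hsY : ∀ a b e, s a (altOp p Y b e) = altOp p Y b (s a e) := by
    intro a b e
    unfold altOp
    by_cases ha : Even a <;> by_cases hb : Even b <;> simp [s, ha, hb, hSp, hTp, hS, hT]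
  refine ⟨Fin.cons (t (m + 1) (T ((X ^ (p - 1)) (e 0)))) fun i => s i (e i), ?_⟩
  ext i
  rw [totD_apply, Fin.cons_succ]
  induction i using Fin.cases with
  | zero =>
    have h0 := congrFun he 0
    rw [totD_apply] at h0
    simp only [Fin.val_zero, pow_zero, one_smul, Fin.castSucc_zero, Fin.cons_zero,
      Nat.sub_zero, Pi.zero_apply, zero_add] at h0 ⊢
    have hX1 : altOp p X 1 = X := by simp [altOp]
    have hs0 : s 0 = S := by simp [s]
    have h3 : ∀ f, T ((X ^ (p - 1)) (altOp p Y (m + 1) f))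
        = altOp p Y (m + 1) (T ((X ^ (p - 1)) f)) := by
      intro f
      have := altOp_comm p X Y hXY 0 (m + 1) f
      simp only [altOp, Even.zero, if_true] at this
      have h4 := hsY 1 (m + 1) ((X ^ (p - 1)) f)
      simp only [s, Nat.not_even_one, if_false] at h4
      rw [← h4]
      congr 1
    have h5 : altOp p Y (m + 1) (T ((X ^ (p - 1)) (e 0))) = 0 := by
      rw [← h3, eq_neg_iff_add_eq_zero.2 ((add_comm _ _).trans h0), hX1, map_neg, map_neg]
      rw [← Module.End.mul_apply, ← pow_succ, Nat.sub_add_cancel hp, hX]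
      simp
    have h6 := ht m (T ((X ^ (p - 1)) (e 0)))
    rw [h5, map_zero, add_zero] at h6
    rw [hX1, hs0, h6, h1]
  | succ j =>
    have h0 := congrFun he j
    rw [totD_apply] at h0
    have h7 := congrArg (s j) h0
    rw [Fin.castSucc_succ, Fin.cons_succ]
    simp only [Fin.val_succ, Fin.val_castSucc]
    rw [show m + 1 + 1 - ((j : ℕ) + 1) = m + 1 - j by omega, ← hsY, pow_succ]
    have h8 := hs j (e j.succ)
    rw [Pi.zero_apply, map_zero, map_add] at h7
    have h9 : s j ((-1 : A) ^ (j : ℕ) • altOp p Y (m + 1 - j) (e j.castSucc))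
        = (-1 : A) ^ (j : ℕ) • s j (altOp p Y (m + 1 - j) (e j.castSucc)) := by
      rcases Nat.even_or_odd (j : ℕ) with h | h <;> simp [h.neg_one_pow]
    rw [h9] at h7
    rw [← eq_sub_iff_add_eq] at h8
    rw [h8]
    rw [eq_neg_of_add_eq_zero_left h7]
    simp
end cplx

open TensorProduct

lemma xA_pow : (xA k p) ^ p = 0 := by
  rw [xA, ← map_pow, Ideal.Quotient.eq_zero_iff_mem]
  exact Ideal.subset_span (by simp)

lemma yA_pow : (yA k p) ^ p = 0 := by
  rw [yA, ← map_pow, Ideal.Quotient.eq_zero_iff_mem]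
  exact Ideal.subset_span (by simp)

lemma pderiv_mem [CharP k p] (i : Fin 2) (f : MvPolynomial (Fin 2) k) (hf : f ∈ relI k p) :
    pderiv i f ∈ relI k p := by
  induction hf using Submodule.span_induction with
  | mem g hg =>
    have : pderiv i g = 0 := by
      rcases hg with rfl | hg
      · simp [Derivation.leibniz_pow]
      · rw [Set.mem_singleton_iff.1 hg]
        simp [Derivation.leibniz_pow]
    rw [this]; exact zero_mem _
  | zero => simp
  | add a b _ _ ha hb => rw [map_add]; exact add_mem ha hb
  | smul a g hg h =>
    rw [smul_eq_mul, Derivation.leibniz, smul_eq_mul, smul_eq_mul]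
    exact add_mem (Ideal.mul_mem_left _ _ h) (Ideal.mul_mem_right _ _ hg)

/-- The derivation induced on the quotient. -/
def dA [CharP k p] (i : Fin 2) : Amod k p →ₗ[k] Amod k p :=
  Submodule.mapQ ((relI k p).restrictScalars k) ((relI k p).restrictScalars k)
    (pderiv i).toLinearMap (fun f hf => pderiv_mem k p i f hf)

lemma dA_mk [CharP k p] (i : Fin 2) (f : MvPolynomial (Fin 2) k) :
    dA k p i (Ideal.Quotient.mk (relI k p) f) = Ideal.Quotient.mk (relI k p) (pderiv i f) := rfl

lemma dA_mul [CharP k p] (i j : Fin 2) (a : Amod k p) :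
    dA k p i (Ideal.Quotient.mk (relI k p) (X j) * a)
      = (if i = j then a else 0) + Ideal.Quotient.mk (relI k p) (X j) * dA k p i a := by
  obtain ⟨f, rfl⟩ := Ideal.Quotient.mk_surjective a
  rw [← map_mul, dA_mk, dA_mk, ← map_mul, Derivation.leibniz, pderiv_X, add_comm, smul_eq_mul,
    smul_eq_mul, map_add]
  congr 1
  by_cases h : i = j
  · subst h; simp
  · simp [h, Ne.symm h]

section ops
variable (M : Type) [AddCommGroup M] [Module (Amod k p) M]
    [Module k M] [IsScalarTower k (Amod k p) M]

/-- The free module `A ⊗ M`. -/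
abbrev FF : Type := Amod k p ⊗[k] M

/-- `a ⊗ 1 - 1 ⊗ a` -/
def opA (a : Amod k p) : Module.End (Amod k p) (FF k p M) :=
  algebraMap (Amod k p) (Module.End (Amod k p) (FF k p M)) a
    - (Algebra.lsmul k k M a).baseChange (Amod k p)

variable {M} in
lemma opA_tmul (a b : Amod k p) (m : M) :
    opA k p M a (b ⊗ₜ m) = (a * b) ⊗ₜ m - b ⊗ₜ (a • m) := rfl

lemma opA_add (a b : Amod k p) : opA k p M (a + b) = opA k p M a + opA k p M b := by
  apply LinearMap.ext; intro f
  induction f using TensorProduct.induction_on with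
  | zero => simp
  | add f g hf hg => rw [map_add, hf, hg, map_add]
  | tmul c m =>
    rw [LinearMap.add_apply, opA_tmul, opA_tmul, opA_tmul, add_mul, add_smul, TensorProduct.add_tmul,
      TensorProduct.tmul_add]
    abel

lemma opA_smul (c : k) (a : Amod k p) : opA k p M (c • a) = c • opA k p M a := by
  apply LinearMap.ext; intro f
  induction f using TensorProduct.induction_on with
  | zero => simp
  | add f g hf hg => rw [map_add, hf, hg, map_add]
  | tmul b m =>
    have h : c • a * b = c • (a * b) := Algebra.smul_mul_assoc c a b
    rw [LinearMap.smul_apply, opA_tmul, opA_tmul, smul_sub, TensorProduct.smul_tmul',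
      ← TensorProduct.tmul_smul, h, smul_assoc]

lemma opA_comm (a b : Amod k p) : Commute (opA k p M a) (opA k p M b) := by
  apply LinearMap.ext; intro f
  induction f using TensorProduct.induction_on with
  | zero => simp
  | add f g hf hg => rw [map_add, hf, hg, map_add]
  | tmul c m =>
    simp only [Module.End.mul_apply, opA_tmul, map_sub]
    rw [mul_left_comm a b c, smul_comm a b m]
    abel

/-- ZMod p algebra structure. -/
@[reducible] def zAlg (p : ℕ) [CharP k p] (R : Type) [Ring R] [Algebra k R] : Algebra (ZMod p) R :=
  letI := ZMod.algebra k p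
  Algebra.compHom R (algebraMap (ZMod p) k)

lemma opA_pow [Fact p.Prime] [CharP k p] (a : Amod k p) (ha : a ^ p = 0) : opA k p M a ^ p = 0 := by
  let := zAlg k p (Module.End (Amod k p) (FF k p M))
  have hc : Commute (algebraMap (Amod k p) (Module.End (Amod k p) (FF k p M)) a)
      ((Algebra.lsmul k k M a).baseChange (Amod k p)) := Algebra.commutes _ _
  have h0 := subPowChar (R := Module.End (Amod k p) (FF k p M)) p _ _ hc
  rw [← map_pow, ha] at h0
  refine Eq.trans h0 ?_
  have : ((Algebra.lsmul k k M a).baseChange (Amod k p)) ^ p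
      = ((Algebra.lsmul k k M (a ^ p)).baseChange (Amod k p)) := by
    rw [map_pow, LinearMap.baseChange_pow]
  rw [this, ha]
  simp

/-- derivation on `A ⊗ M` -/
def opD [CharP k p] (i : Fin 2) : Module.End k (FF k p M) := (dA k p i).rTensor M

lemma opD_comm [CharP k p] (i j : Fin 2) (f : FF k p M) :
    opD k p M i (opA k p M (Ideal.Quotient.mk (relI k p) (X j)) f)
      = opA k p M (Ideal.Quotient.mk (relI k p) (X j)) (opD k p M i f)
        + (if i = j then f else 0) := by
  induction f using TensorProduct.induction_on with
  | zero => simp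
  | add f g hf hg => rw [map_add, map_add, hf, hg, map_add, map_add]; split_ifs <;> abel
  | tmul c m =>
    simp only [opA_tmul, map_sub, opD, LinearMap.rTensor_tmul, dA_mul, TensorProduct.add_tmul]
    split_ifs
    · abel
    · simp

lemma exists_ST [Fact p.Prime] [CharP k p] (i : Fin 2) :
    ∃ S T : FF k p M →+ FF k p M,
      (∀ e, opA k p M (Ideal.Quotient.mk (relI k p) (X i)) (S e) +
        T ((opA k p M (Ideal.Quotient.mk (relI k p) (X i)) ^ (p - 1)) e) = e) ∧
      (∀ e, S (opA k p M (Ideal.Quotient.mk (relI k p) (X i)) e) +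
        (opA k p M (Ideal.Quotient.mk (relI k p) (X i)) ^ (p - 1)) (T e) = e) ∧
      ∀ j ≠ i, (∀ e, S (opA k p M (Ideal.Quotient.mk (relI k p) (X j)) e)
          = opA k p M (Ideal.Quotient.mk (relI k p) (X j)) (S e)) ∧
        (∀ e, T (opA k p M (Ideal.Quotient.mk (relI k p) (X j)) e)
          = opA k p M (Ideal.Quotient.mk (relI k p) (X j)) (T e)) := by
  let Z : Fin 2 → Module.End k (FF k p M) := fun j =>
    (opA k p M (Ideal.Quotient.mk (relI k p) (X j))).restrictScalars k
  have hZ : ∀ j e, opA k p M (Ideal.Quotient.mk (relI k p) (X j)) e = Z j e := fun _ _ => rfl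
  have hZp : ∀ j n e, (opA k p M (Ideal.Quotient.mk (relI k p) (X j)) ^ n) e = (Z j ^ n) e := by
    intro j n
    induction n with
    | zero => intro e; rfl
    | succ n ih => intro e; rw [pow_succ, pow_succ, Module.End.mul_apply, Module.End.mul_apply, ih, hZ]
  let D := opD k p M i
  have hD : D * Z i = Z i * D + 1 := by
    apply LinearMap.ext; intro f
    have := opD_comm k p M i i f
    rw [if_pos rfl] at this
    exact this
  have hDj : ∀ j ≠ i, Commute D (Z j) := by
    intro j hj
    apply LinearMap.ext; intro f
    have := opD_comm k p M i j f
    rw [if_neg hj.symm, add_zero] at this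
    exact this
  have hZj : ∀ j, Commute (Z i) (Z j) := by
    intro j
    apply LinearMap.ext; intro f
    exact congrArg (fun g => g f) (opA_comm k p M _ _).eq
  let := zAlg k p (Module.End k (FF k p M))
  refine ⟨(D * (Z i * D) ^ (p - 2)).toAddMonoidHom, (-D ^ (p - 1)).toAddMonoidHom, ?_, ?_, ?_⟩
  · intro e
    simp only [hZ, hZp]
    exact congrArg (fun g => g e) (weyl1 p (Z i) D hD)
  · intro e
    simp only [hZ, hZp]
    exact congrArg (fun g => g e) (weyl2 p (Z i) D hD)
  · intro j hj
    refine ⟨fun e => ?_, fun e => ?_⟩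
    · have : Commute (D * (Z i * D) ^ (p - 2)) (Z j) :=
        (hDj j hj).mul_left (((hZj j).mul_left (hDj j hj)).pow_left _)
      exact congrArg (fun g => g e) this.eq
    · have : Commute (D ^ (p - 1)) (Z j) := (hDj j hj).pow_left _
      have h := congrArg (fun g => -(g e)) this.eq
      refine Eq.trans h ?_
      exact (map_neg (Z j) _).symm

/-- augmentation -/
def augA : FF k p M →ₗ[Amod k p] M :=
  (LinearMap.id : M →ₗ[k] M).liftBaseChange (Amod k p)

lemma augA_tmul (a : Amod k p) (m : M) : augA k p M (a ⊗ₜ m) = a • m := by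
  simp [augA]

lemma augA_op (a : Amod k p) (f : FF k p M) : augA k p M (opA k p M a f) = 0 := by
  induction f using TensorProduct.induction_on with
  | zero => simp
  | add f g hf hg => rw [map_add, map_add, hf, hg, add_zero]
  | tmul c m =>
    rw [opA_tmul, map_sub, augA_tmul, augA_tmul, mul_comm, mul_smul, sub_self]

lemma augA_ker (f : FF k p M) (hf : augA k p M f = 0) :
    ∃ g h, opA k p M (xA k p) g + opA k p M (yA k p) h = f := by
  let N : Submodule (Amod k p) (FF k p M) :=
    LinearMap.range (opA k p M (xA k p)) ⊔ LinearMap.range (opA k p M (yA k p))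
  have hx : ∀ e, opA k p M (xA k p) e ∈ N := fun e => Submodule.mem_sup_left ⟨e, rfl⟩
  have hy : ∀ e, opA k p M (yA k p) e ∈ N := fun e => Submodule.mem_sup_right ⟨e, rfl⟩
  have h1 : ∀ (g : MvPolynomial (Fin 2) k) (m : M), Ideal.Quotient.mk (relI k p) g ⊗ₜ[k] m
      - 1 ⊗ₜ (Ideal.Quotient.mk (relI k p) g • m) ∈ N := by
    intro g
    induction g using MvPolynomial.induction_on with
    | C c =>
      intro m
      have : Ideal.Quotient.mk (relI k p) (C c) = c • (1 : Amod k p) := by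
        rw [← Algebra.algebraMap_eq_smul_one]; rfl
      rw [this, smul_assoc, one_smul, TensorProduct.smul_tmul, sub_self]
      exact zero_mem _
    | add g h hg hh =>
      intro m
      rw [map_add, TensorProduct.add_tmul, add_smul, TensorProduct.tmul_add]
      have := add_mem (hg m) (hh m)
      convert this using 1
      abel
    | mul_X g i hg =>
      intro m
      have h2 : opA k p M (Ideal.Quotient.mk (relI k p) (X i))
          (Ideal.Quotient.mk (relI k p) g ⊗ₜ m) ∈ N := by
        fin_cases i
        · exact hx _
        · exact hy _
      rw [opA_tmul] at h2
      have := add_mem h2 (hg (Ideal.Quotient.mk (relI k p) (X i) • m))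
      convert this using 1
      rw [map_mul, mul_comm, smul_smul, mul_comm (Ideal.Quotient.mk (relI k p) (X i))]
      rw [mul_comm]
      abel
  have h3 : ∀ f : FF k p M, f - 1 ⊗ₜ augA k p M f ∈ N := by
    intro f
    induction f using TensorProduct.induction_on with
    | zero => simp
    | add f g hf hg =>
      rw [map_add, TensorProduct.tmul_add]
      have := add_mem hf hg
      convert this using 1
      abel
    | tmul c m =>
      obtain ⟨g, rfl⟩ := Ideal.Quotient.mk_surjective c
      rw [augA_tmul]
      exact h1 g m
  have h4 := h3 f
  rw [hf, TensorProduct.tmul_zero, sub_zero] at h4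
  obtain ⟨_, ⟨g, rfl⟩, _, ⟨h, rfl⟩, h5⟩ := Submodule.mem_sup.1 h4
  exact ⟨g, h, h5⟩

end ops


section chain
variable {A F : Type} [CommRing A] [AddCommGroup F] [Module A F]

lemma exists_Q {R : Type*} [Ring R] (p : ℕ) [Fact p.Prime] [Algebra (ZMod p) R] [Algebra A R]
    (X Y : R) (hXY : Commute X Y) (a : A) :
    ∃ Q : R, X * Q = (a • X + Y) ^ (p - 1) - Y ^ (p - 1) ∧
      Y * Q = a ^ p • X ^ (p - 1) - a • (a • X + Y) ^ (p - 1) := by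
  have hp : 1 < p := (Fact.out : p.Prime).one_lt
  set U := a • X + Y with hU
  have hUY : Commute U Y := (hXY.smul_left a).add_left (Commute.refl Y)
  have hsub : U - Y = a • X := by simp [hU]
  refine ⟨a • ∑ i ∈ Finset.range (p - 1), U ^ i * Y ^ (p - 1 - 1 - i), ?_, ?_⟩
  · rw [← hUY.mul_geom_sum₂, hsub, mul_smul_comm, smul_mul_assoc]
  · have h := geomChar p U Y hUY
    rw [hsub, smul_pow] at h
    have h2 : Y * ∑ i ∈ Finset.range (p - 1), U ^ i * Y ^ (p - 1 - 1 - i)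
        = a ^ (p - 1) • X ^ (p - 1) - U ^ (p - 1) := by
      rw [← h]
      obtain ⟨q, rfl⟩ : ∃ q, p = q + 1 := ⟨p - 1, by omega⟩
      rw [Finset.sum_range_succ]
      simp only [Nat.add_sub_cancel, Nat.sub_self, pow_zero, mul_one, add_sub_cancel_right]
      rw [Finset.mul_sum]
      refine Finset.sum_congr rfl fun i hi => ?_
      have hi := Finset.mem_range.1 hi
      rw [← mul_assoc, (hUY.symm.pow_right i).eq, mul_assoc, ← pow_succ']
      congr 2
      omega
    rw [mul_smul_comm, h2, smul_sub, smul_smul, ← pow_succ', show p - 1 + 1 = p by omega]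

/-- test chain in even degree -/
def zEven (p : ℕ) (Q : Module.End A F) (a : A) (m : ℕ) (w : F) : Fin m → F :=
  fun i => a ^ (p * (i / 2)) • (if Even (i : ℕ) then w else Q w)

/-- test chain in odd degree -/
def zOdd (p : ℕ) (a : A) (m : ℕ) (w : F) : Fin m → F :=
  fun i => (a ^ (p * (i / 2)) * (if Even (i : ℕ) then 1 else a)) • w

lemma totD_zEven (p : ℕ) (X Y Q : Module.End A F) (a : A)
    (hQ1 : X * Q = (a • X + Y) ^ (p - 1) - Y ^ (p - 1))
    (hQ2 : Y * Q = a ^ p • X ^ (p - 1) - a • (a • X + Y) ^ (p - 1)) (m : ℕ) (hm : Odd m) (w : F) :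
    totD p X Y m (zEven p Q a (m + 2) w) = zOdd p a (m + 1) (((a • X + Y) ^ (p - 1)) w) := by
  set U := a • X + Y
  have q1 : X (Q w) = (U ^ (p - 1)) w - (Y ^ (p - 1)) w := by
    rw [← Module.End.mul_apply, hQ1, LinearMap.sub_apply]
  have q2 : Y (Q w) = a ^ p • (X ^ (p - 1)) w - a • (U ^ (p - 1)) w := by
    rw [← Module.End.mul_apply, hQ2, LinearMap.sub_apply, LinearMap.smul_apply, LinearMap.smul_apply]
  ext i
  rw [totD_apply]
  simp only [zEven, zOdd, Fin.val_succ, Fin.val_castSucc, altOp]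
  obtain ⟨r, hi⟩ := i
  dsimp only
  rcases Nat.even_or_odd' r with ⟨j, hj | hj⟩
  · subst hj
    have e1 : Even (m + 1 - 2 * j) := by
      rw [Nat.even_sub (by omega)]; simp [hm.add_one]
    have e2 : ¬ Even (2 * j + 1) := by simp
    simp only [e1, e2, if_true, if_false, even_two_mul, (even_two_mul j).neg_pow, one_pow, one_smul,
      map_smul, mul_one]
    rw [show (2 * j + 1) / 2 = j by omega, show (2 * j) / 2 = j by omega, q1, smul_sub]
    abel
  · subst hj
    have e1 : ¬ Even (m + 1 - (2 * j + 1)) := by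
      rw [Nat.even_sub (by omega)]; simp [hm.add_one]
    have e2 : ¬ Even (2 * j + 1) := by simp
    have e3 : Even (2 * j + 1 + 1) := by simp [Nat.even_add_one]
    simp only [e1, e2, e3, if_true, if_false, (odd_two_mul_add_one j).neg_pow, one_pow,
      map_smul]
    rw [show (2 * j + 1 + 1) / 2 = j + 1 by omega, show (2 * j + 1) / 2 = j by omega, q2, smul_sub,
      mul_add, pow_add, mul_one, mul_smul, mul_smul, neg_smul, one_smul]
    abel

end chain

section ops2
open TensorProduct
variable (M : Type) [AddCommGroup M] [Module (Amod k p) M]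
    [Module k M] [IsScalarTower k (Amod k p) M]

lemma opA_pow_one (u : Amod k p) (j : ℕ) (m : M) :
    ∃ f : FF k p M, (opA k p M u ^ j) (1 ⊗ₜ m) = u • f + (-1 : Amod k p) ^ j • (1 ⊗ₜ (u ^ j • m)) := by
  induction j with
  | zero => exact ⟨0, by simp⟩
  | succ j ih =>
    obtain ⟨f, hf⟩ := ih
    refine ⟨opA k p M u f + (-1 : Amod k p) ^ j • (1 ⊗ₜ (u ^ j • m)), ?_⟩
    have h1 : opA k p M u ((1 : Amod k p) ⊗ₜ[k] (u ^ j • m))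
        = u • ((1 : Amod k p) ⊗ₜ[k] (u ^ j • m)) - (1 : Amod k p) ⊗ₜ[k] (u ^ (j + 1) • m) := by
      rw [opA_tmul, pow_succ', mul_smul u]
      rfl
    have h2 : ∀ z : FF k p M, (-1 : Amod k p) ^ (j + 1) • z = - ((-1 : Amod k p) ^ j • z) := by
      intro z
      have : (-1 : Amod k p) ^ (j + 1) = - (-1 : Amod k p) ^ j := by ring
      rw [this]
      exact neg_smul (R := Amod k p) (M := FF k p M) ((-1) ^ j) z
    rw [pow_succ', Module.End.mul_apply, hf, map_add, map_smul, map_smul, h1, h2, smul_add, smul_sub,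
      smul_comm u ((-1 : Amod k p) ^ j)]
    abel

/-- cocycles -/
def cocyc (n : ℕ) (i : Fin (n + 1)) : (Fin (2 * n + 1) → FF k p M) →ₗ[Amod k p] M :=
  augA k p M ∘ₗ LinearMap.proj (⟨2 * i, by omega⟩ : Fin (2 * n + 1))

lemma augA_altOp (hp : 1 < p) (a : Amod k p) (j : ℕ) (f : FF k p M) :
    augA k p M (altOp p (opA k p M a) j f) = 0 := by
  unfold altOp
  split_ifs
  · rw [show p - 1 = (p - 2) + 1 by omega, pow_succ', Module.End.mul_apply, augA_op]
  · rw [augA_op]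

lemma cocyc_totD (hp : 1 < p) (n : ℕ) (i : Fin (n + 1)) (e : Fin (2 * n + 2) → FF k p M) :
    cocyc k p M n i (totD p (opA k p M (xA k p)) (opA k p M (yA k p)) (2 * n) e) = 0 := by
  change augA k p M (totD p (opA k p M (xA k p)) (opA k p M (yA k p)) (2 * n) e _) = 0
  rw [totD_apply, map_add, map_smul, augA_altOp k p M hp, augA_altOp k p M hp]
  simp

lemma nilp (u : Amod k p) (N : ℕ) (hu : ∀ m : M, u ^ N • m = 0) (h : ∀ m : M, ∃ m', m = u • m') :
    ∀ m : M, m = 0 := by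
  have : ∀ j, ∀ m : M, ∃ m', m = u ^ j • m' := by
    intro j
    induction j with
    | zero => exact fun m => ⟨m, by simp⟩
    | succ j ih =>
      intro m
      obtain ⟨m1, h1⟩ := ih m
      obtain ⟨m2, h2⟩ := h m1
      exact ⟨m2, by rw [pow_succ, mul_smul, ← h2, ← h1]⟩
  intro m
  obtain ⟨m', h'⟩ := this N m
  rw [h', hu]

lemma cocyc_indep [IsAlgClosed k] [Fact p.Prime] [CharP k p] [Nontrivial M]
    (hE : (mA k p) ^ (p - 1) • (⊤ : Submodule (Amod k p) M) = ⊥) (n : ℕ) (m : ℕ) (hm : m + 1 = 2 * n)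
    (g : (Fin (m + 1) → FF k p M) →ₗ[Amod k p] M) (c : Fin (n + 1) → k)
    (hc : ∀ e : Fin (m + 2) → FF k p M,
      g (totD p (opA k p M (xA k p)) (opA k p M (yA k p)) m e)
        = ∑ i, c i • cocyc k p M n i (fun j => e (j.cast (by omega)))) : c = 0 := by
  have hp : 1 < p := (Fact.out : p.Prime).one_lt
  let P : Polynomial k := ∑ i : Fin (n + 1), Polynomial.C (c i) * Polynomial.X ^ (i : ℕ)
  have hP : ∀ t : k, P.eval t = 0 := by
    intro t
    obtain ⟨α, hα⟩ := IsAlgClosed.exists_pow_nat_eq t (show 0 < p by omega)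
    by_contra hne
    let a : Amod k p := algebraMap k _ α
    let u : Amod k p := α • xA k p + yA k p
    have hum : u ∈ mA k p := by
      have h1 : xA k p ∈ mA k p := Ideal.subset_span (by simp)
      have h2 : yA k p ∈ mA k p := Ideal.subset_span (by simp)
      have h3 : α • xA k p = a * xA k p :=
        Algebra.smul_def (R := k) (A := Amod k p) α (xA k p)
      refine add_mem ?_ h2
      rw [h3]
      exact Ideal.mul_mem_left _ _ h1
    have hu : ∀ v : M, u ^ (p - 1) • v = 0 := by
      intro v
      have : u ^ (p - 1) • v ∈ (mA k p) ^ (p - 1) • (⊤ : Submodule (Amod k p) M) :=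
        Submodule.smul_mem_smul (Ideal.pow_mem_pow hum _) trivial
      rw [hE] at this
      simpa using this
    let := zAlg k p (Module.End (Amod k p) (FF k p M))
    obtain ⟨Q, hQ1, hQ2⟩ := exists_Q (R := Module.End (Amod k p) (FF k p M)) p _ _
      (opA_comm k p M (xA k p) (yA k p)) a
    have hU : a • opA k p M (xA k p) + opA k p M (yA k p) = opA k p M u := by
      rw [opA_add, opA_smul]
      congr 1
      apply LinearMap.ext; intro f
      exact algebraMap_smul (Amod k p) α (opA k p M (xA k p) f)
    have hodd : Odd m := by
      rcases Nat.even_or_odd m with h | h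
      · exfalso
        obtain ⟨r, hr⟩ := h
        omega
      · exact h
    have key : ∀ v : M, ∃ v' : M, v = u • v' := by
      intro v
      have h1 := hc (zEven p Q a (m + 2) (1 ⊗ₜ v))
      rw [totD_zEven p _ _ Q a hQ1 hQ2 m hodd, hU] at h1
      have h2 : ∑ i, c i • cocyc k p M n i
          (fun j => zEven p Q a (m + 2) ((1 : Amod k p) ⊗ₜ[k] v) (j.cast (by omega)))
          = P.eval t • v := by
        rw [Polynomial.eval_finsetSum, Finset.sum_smul]
        refine Finset.sum_congr rfl fun i _ => ?_
        have h3 : cocyc k p M n i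
          (fun j => zEven p Q a (m + 2) ((1 : Amod k p) ⊗ₜ[k] v) (j.cast (by omega)))
            = augA k p M (a ^ (p * ((2 * i) / 2)) • (if Even (2 * (i : ℕ)) then (1 ⊗ₜ v) else Q (1 ⊗ₜ v))) := rfl
        rw [h3, if_pos (even_two_mul _), map_smul, augA_tmul, one_smul,
          show (2 * (i : ℕ)) / 2 = i by omega, pow_mul, ← map_pow, ← map_pow, algebraMap_smul, hα]
        simp [mul_smul]
      rw [h2] at h1
      obtain ⟨f, hf⟩ := opA_pow_one k p M u (p - 1) v
      rw [hu, TensorProduct.tmul_zero, smul_zero, add_zero] at hf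
      rw [hf] at h1
      have h4 : zOdd p a (m + 1) (u • f) = u • zOdd p a (m + 1) f := by
        ext i
        simp only [zOdd, Pi.smul_apply]
        rw [smul_comm]
      rw [h4, map_smul] at h1
      refine ⟨(P.eval t)⁻¹ • g (zOdd p a (m + 1) f), ?_⟩
      rw [smul_comm u, h1, smul_smul, inv_mul_cancel₀ hne, one_smul]
    obtain ⟨v, hv⟩ := exists_ne (0 : M)
    exact hv (nilp k p M u (p - 1) hu key v)
  have hP0 : P = 0 := Polynomial.funext (by simpa using hP)
  funext i
  have := congrArg (fun f => Polynomial.coeff f (i : ℕ)) hP0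
  simp only [P, Polynomial.finsetSum_coeff, Polynomial.coeff_C_mul, Polynomial.coeff_X_pow] at this
  simpa [Fin.val_inj] using this

end ops2


section cat
open CategoryTheory CategoryTheory.Limits TensorProduct

lemma finrank_homology_ge (S : ShortComplex (ModuleCat.{0} k)) (n : ℕ) (hfin : Module.Finite k S.X₂)
    (v : Fin n → S.X₂) (hv : ∀ i, S.g.hom (v i) = 0)
    (hi : ∀ c : Fin n → k, (∃ y, S.f.hom y = ∑ i, c i • v i) → c = 0) :
    n ≤ finrank k S.homology := by
  have e : S.homology ≃ₗ[k] (LinearMap.ker S.g.hom ⧸ LinearMap.range S.moduleCatToCycles) :=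
    S.moduleCatHomologyIso.toLinearEquiv
  rw [e.finrank_eq]
  let w : Fin n → LinearMap.ker S.g.hom := fun i => ⟨v i, hv i⟩
  have hli : LinearIndependent k (fun i => (LinearMap.range S.moduleCatToCycles).mkQ (w i)) := by
    rw [Fintype.linearIndependent_iff]
    intro c hc
    simp only [← map_smul, ← map_sum] at hc
    have hc2 := (Submodule.Quotient.mk_eq_zero _).1 hc
    obtain ⟨y, hy⟩ := hc2
    have h3 := congrArg (Subtype.val) hy
    have := hi c ⟨y, by
      refine Eq.trans h3 ?_
      simp [w]⟩
    intro i
    rw [this]; rfl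
  simpa using hli.fintype_card_le_finrank

variable [Fact p.Prime] [CharP k p] 
variable (M : Type) [AddCommGroup M] [Module (Amod k p) M]
    [Module k M] [IsScalarTower k (Amod k p) M]

/-- The differential -/
abbrev dd (m : ℕ) : (Fin (m + 2) → FF k p M) →ₗ[Amod k p] (Fin (m + 1) → FF k p M) :=
  totD p (opA k p M (xA k p)) (opA k p M (yA k p)) m

lemma dd_sq (m : ℕ) (e) : dd k p M m (dd k p M (m + 1) e) = 0 :=
  totD_sq p (Fact.out : p.Prime).pos _ _ (opA_pow k p M _ (xA_pow k p))
    (opA_pow k p M _ (yA_pow k p)) (opA_comm k p M _ _) m e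

lemma dd_exact (m : ℕ) (e) (he : dd k p M m e = 0) : ∃ e', dd k p M (m + 1) e' = e := by
  obtain ⟨S, T, h1, h2, h3⟩ := exists_ST k p M 0
  obtain ⟨S', T', h1', h2', -⟩ := exists_ST k p M 1
  obtain ⟨h3, h4⟩ := h3 1 (by simp)
  exact totD_exact p _ _ S T S' T' h1 h2 h1' h2' (Fact.out : p.Prime).pos
    (opA_pow k p M _ (xA_pow k p)) (opA_comm k p M _ _) h3 h4 m e he

/-- total augmentation -/
def aug0 : (Fin 1 → FF k p M) →ₗ[Amod k p] M := augA k p M ∘ₗ LinearMap.proj 0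

lemma aug0_surj : Function.Surjective (aug0 k p M) := fun m =>
  ⟨fun _ => 1 ⊗ₜ m, by
    change augA k p M (1 ⊗ₜ m) = m
    rw [augA_tmul, one_smul]⟩

lemma aug0_dd (e) : aug0 k p M (dd k p M 0 e) = 0 := by
  change augA k p M (totD p (opA k p M (xA k p)) (opA k p M (yA k p)) 0 e 0) = 0
  rw [totD_apply, map_add, map_smul, augA_altOp k p M (Fact.out : p.Prime).one_lt,
    augA_altOp k p M (Fact.out : p.Prime).one_lt]
  simp

lemma aug0_exact (e) (he : aug0 k p M e = 0) : ∃ e', dd k p M 0 e' = e := by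
  obtain ⟨g, h, hgh⟩ := augA_ker k p M (e 0) he
  refine ⟨![h, g], ?_⟩
  ext i
  have : i = 0 := Fin.fin_one_eq_zero i
  subst this
  rw [totD_apply]
  simpa [altOp] using hgh

/-- The complex. -/
def cplx : ChainComplex (ModuleCat.{0} (Amod k p)) ℕ :=
  ChainComplex.of (fun m => ModuleCat.of (Amod k p) (Fin (m + 1) → FF k p M))
    (fun m => ModuleCat.ofHom (dd k p M m))
    (fun m => by
      apply ModuleCat.hom_ext
      apply LinearMap.ext
      intro e
      exact dd_sq k p M m e)

lemma cplx_d (m : ℕ) : (cplx k p M).d (m + 1) m = ModuleCat.ofHom (dd k p M m) := by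
  exact ChainComplex.of_d (α := ℕ) (fun m => ModuleCat.of (Amod k p) (Fin (m + 1) → FF k p M))
    (fun m => ModuleCat.ofHom (dd k p M m)) m

instance projX (m : ℕ) : Projective ((cplx k p M).X m) := by
  have : Module.Projective (Amod k p) (Fin (m + 1) → FF k p M) := inferInstance
  exact (IsProjective.iff_projective (R := Amod k p) (Fin (m + 1) → FF k p M)).1 this

/-- augmentation as map of complexes -/
def cplxπ : cplx k p M ⟶ (ChainComplex.single₀ _).obj (ModuleCat.of (Amod k p) M) :=
  (ChainComplex.toSingle₀Equiv _ _).symm ⟨ModuleCat.ofHom (aug0 k p M), by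
    rw [cplx_d]
    apply ModuleCat.hom_ext
    apply LinearMap.ext
    intro e
    exact aug0_dd k p M e⟩

lemma cplxπ_f : (cplxπ k p M).f 0 = ModuleCat.ofHom (aug0 k p M) := by
  exact ChainComplex.toSingle₀Equiv_symm_apply_f_zero _ _

lemma exactAt_succ (m : ℕ) : (cplx k p M).ExactAt (m + 1) := by
  rw [HomologicalComplex.exactAt_iff' _ (m + 2) (m + 1) m (by simp) (by simp),
    ShortComplex.moduleCat_exact_iff]
  intro e he
  have he' : ((cplx k p M).d (m + 1) m).hom e = 0 := he
  rw [cplx_d] at he'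
  obtain ⟨e', h⟩ := dd_exact k p M m e he'
  refine ⟨e', ?_⟩
  change ((cplx k p M).d (m + 1 + 1) (m + 1)).hom e' = e
  rw [cplx_d]
  exact h

lemma quasi : QuasiIso (cplxπ k p M) := ⟨fun n => by
    cases n
    · rw [ChainComplex.quasiIsoAt₀_iff, ShortComplex.quasiIso_iff_of_zeros']
      · constructor
        · rw [ShortComplex.moduleCat_exact_iff]
          intro e he
          have he' : aug0 k p M e = 0 := by
            have h1 : ((cplxπ k p M).f 0).hom e = 0 := he
            rw [cplxπ_f] at h1
            exact h1
          obtain ⟨e', h⟩ := aug0_exact k p M e he'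
          refine ⟨e', ?_⟩
          change ((cplx k p M).d (0 + 1) 0).hom e' = e
          rw [cplx_d]
          exact h
        · change Epi ((cplxπ k p M).f 0)
          rw [cplxπ_f]
          exact (ModuleCat.epi_iff_surjective _).2 (aug0_surj k p M)
      all_goals rfl
    · rw [quasiIsoAt_iff_exactAt']
      · apply exactAt_succ
      · apply ChainComplex.exactAt_succ_single_obj⟩

/-- The resolution -/
def resn : ProjectiveResolution (ModuleCat.of (Amod k p) M) where
  complex := cplx k p M
  π := cplxπ k p M
  quasiIso := quasi k p M




/-- Hom complex -/
abbrev HX (m : ℕ) : ModuleCat.{0} k :=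
  ((cplx k p M).linearYonedaObj k (ModuleCat.of (Amod k p) M)).X m

/-- underlying linear map -/
def toLin (m : ℕ) (g : HX k p M m) : (Fin (m + 1) → FF k p M) →ₗ[Amod k p] M :=
  ModuleCat.Hom.hom (A := ModuleCat.of (Amod k p) (Fin (m + 1) → FF k p M))
    (B := ModuleCat.of (Amod k p) M) g

/-- inverse direction -/
def ofLin (m : ℕ) (g : (Fin (m + 1) → FF k p M) →ₗ[Amod k p] M) : HX k p M m :=
  ModuleCat.ofHom g

lemma toLin_inj (m : ℕ) : Function.Injective (toLin k p M m) := fun g h hgh =>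
  ModuleCat.hom_ext (M := ModuleCat.of (Amod k p) (Fin (m + 1) → FF k p M))
    (N := ModuleCat.of (Amod k p) M) hgh

lemma toLin_add (m : ℕ) (g h : HX k p M m) (e) :
    toLin k p M m (g + h) e = toLin k p M m g e + toLin k p M m h e := rfl

lemma toLin_ofLin (m : ℕ) (g) : toLin k p M m (ofLin k p M m g) = g := rfl

lemma toLin_smul (m : ℕ) (c : k) (g : HX k p M m) (e) :
    toLin k p M m (c • g) e = c • toLin k p M m g e := by
  have h : toLin k p M m (c • g) e = (algebraMap k (Amod k p) c • toLin k p M m g e) := rfl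
  rw [h, algebraMap_smul]

/-- evaluation on generators -/
def evalHom {ι : Type} (b : ι → M) (m : ℕ) : HX k p M m →ₗ[k] (Fin (m + 1) → ι → M) where
  toFun g i j := toLin k p M m g (Pi.single i ((1 : Amod k p) ⊗ₜ[k] b j))
  map_add' g h := rfl
  map_smul' c g := by
    funext i j
    exact toLin_smul k p M m c g _

lemma evalHom_inj {ι : Type} (b : Basis ι k M) (m : ℕ) :
    Function.Injective (evalHom k p M b m) := by
  intro g h hgh
  apply toLin_inj
  apply LinearMap.pi_ext'
  intro i
  apply TensorProduct.AlgebraTensorModule.curry_injective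
  apply LinearMap.ext_ring
  apply b.ext
  intro j
  exact congrFun (congrFun hgh i) j

lemma fin_hom [FiniteDimensional k M] (m : ℕ) :
    Module.Finite k (HX k p M m) :=
  Module.Finite.of_injective (evalHom k p M (finBasis k M) m) (evalHom_inj k p M _ m)

lemma toLin_zero (m : ℕ) : toLin k p M m 0 = 0 := rfl

lemma toLin_sum (m n : ℕ) (c : Fin n → k) (v : Fin n → HX k p M m) (e) :
    toLin k p M m (∑ i, c i • v i) e = ∑ i, c i • toLin k p M m (v i) e := by
  let T : HX k p M m →+ M :=
    { toFun := fun g => toLin k p M m g e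
      map_zero' := rfl
      map_add' := fun g h => toLin_add k p M m g h e }
  refine (map_sum T _ _).trans (Finset.sum_congr rfl fun i _ => ?_)
  exact toLin_smul k p M m (c i) (v i) e

lemma toLin_d (m : ℕ) (g : HX k p M m) (e) :
    toLin k p M (m + 1)
      ((((cplx k p M).linearYonedaObj k (ModuleCat.of (Amod k p) M)).d m (m + 1)).hom g) e
      = toLin k p M m g (dd k p M m e) := by
  have h := cplx_d k p M m
  have : toLin k p M (m + 1)
      ((((cplx k p M).linearYonedaObj k (ModuleCat.of (Amod k p) M)).d m (m + 1)).hom g) e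
      = toLin k p M m g (((cplx k p M).d (m + 1) m).hom e) := rfl
  rw [this, h]
  rfl

lemma toLin_d' (m N : ℕ) (h : m + 1 = N) (g : HX k p M m) (e : Fin (N + 1) → FF k p M) :
    toLin k p M N
      ((((cplx k p M).linearYonedaObj k (ModuleCat.of (Amod k p) M)).d m N).hom g) e
      = toLin k p M m g (dd k p M m (fun i => e (i.cast (by omega)))) := by
  subst h
  exact toLin_d k p M m g e

lemma main_lemma [IsAlgClosed k] [FiniteDimensional k M] [Nontrivial M]
    (hE : (mA k p) ^ (p - 1) • (⊤ : Submodule (Amod k p) M) = ⊥) (n : ℕ) :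
    n + 1 ≤ finrank k (((cplx k p M).linearYonedaObj k (ModuleCat.of (Amod k p) M)).homology (2 * n)) := by
  have hp : 1 < p := (Fact.out : p.Prime).one_lt
  refine finrank_homology_ge k (((cplx k p M).linearYonedaObj k (ModuleCat.of (Amod k p) M)).sc (2 * n))
    (n + 1) (fin_hom k p M (2 * n)) (fun i => ofLin k p M _ (cocyc k p M n i)) ?_ ?_
  · intro i
    have key : ∀ j, 2 * n + 1 = j →
        (((cplx k p M).linearYonedaObj k (ModuleCat.of (Amod k p) M)).d (2 * n) j).hom
          (ofLin k p M _ (cocyc k p M n i)) = 0 := by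
      rintro j rfl
      apply toLin_inj
      apply LinearMap.ext
      intro e
      rw [toLin_d, toLin_ofLin]
      exact cocyc_totD k p M hp n i e
    exact key _ (CochainComplex.next ℕ (2 * n)).symm
  · rintro c ⟨g, hg⟩
    have hg' : (((cplx k p M).linearYonedaObj k (ModuleCat.of (Amod k p) M)).d
        ((ComplexShape.up ℕ).prev (2 * n)) (2 * n)).hom g
          = ∑ i, c i • ofLin k p M _ (cocyc k p M n i) := hg
    rcases Nat.eq_zero_or_pos n with h0 | hpos
    · subst h0
      rw [HomologicalComplex.shape _ _ _ (by simp)] at hg'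
      obtain ⟨v, hv⟩ := exists_ne (0 : M)
      have h1 := congrArg (fun z => toLin k p M _ z (fun _ => (1 : Amod k p) ⊗ₜ[k] v)) hg'
      rw [toLin_sum] at h1
      have h2 : (0 : M) = ∑ i, c i • (1 : Amod k p) • v := by
        refine h1.trans (Finset.sum_congr rfl fun i _ => ?_)
        rw [← augA_tmul]
        rfl
      simp only [one_smul, Nat.reduceAdd, Finset.univ_unique, Fin.default_eq_zero,
        Finset.sum_singleton] at h2
      funext i
      rw [Fin.fin_one_eq_zero i]
      exact (smul_eq_zero.1 h2.symm).resolve_right hv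
    · have hm : (ComplexShape.up ℕ).prev (2 * n) + 1 = 2 * n :=
        (ComplexShape.up ℕ).prev_eq' (show 2 * n - 1 + 1 = 2 * n by omega) ▸ (by omega)
      refine cocyc_indep k p M hE n _ hm (toLin k p M _ g) c fun e => ?_
      have h1 := toLin_d' k p M _ _ hm g (fun j => e (j.cast (by omega)))
      rw [hg', toLin_sum] at h1
      exact h1.symm

end cat



open CategoryTheory in
/-- if `M ≠ 0` lies in `EIP_{p−1}`, then
`dim_k Ext_A^{2n}(M, M) ≥ n + 1` for every `n ≥ 0`. -/
theorem finrank_ext_ge_of_EIPd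
    [IsAlgClosed k] [Fact p.Prime] [CharP k p]
    (M : Type) [AddCommGroup M] [Module (Amod k p) M]
    [Module k M] [IsScalarTower k (Amod k p) M] [FiniteDimensional k M]
    (hM : Nontrivial M) (hE : EIPd k p (p - 1) M) (n : ℕ) :
    n + 1 ≤ finrank k
      (((Ext k (ModuleCat (Amod k p)) (2 * n)).obj
          (Opposite.op (ModuleCat.of (Amod k p) M))).obj
        (ModuleCat.of (Amod k p) M)) := by
  have e := ((resn k p M).isoExt (R := k) (2 * n) (ModuleCat.of (Amod k p) M)).toLinearEquiv
  rw [e.finrank_eq]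
  exact main_lemma k p M hE.2 n

end
end
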